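/- arXiv:0908.4327 — 3 statements merged into one kernel-verified Lean document; each statement's English description precedes it below -/
import Mathlib

section
/- A_{in}(x) = 0 for all points x ∈ ∂ℝ^n_+ and all indices i ∈ {1,…,n−1}. -/
noncomputable section

open MeasureTheory Metric

/-- Euclidean space `ℝ^n`. -/
abbrev Euc (n : ℕ) := EuclideanSpace ℝ (Fin n)

/-- Partial derivative in the `i`-th coordinate direction. -/
def pd {n : ℕ} (i : Fin n) (f : Euc n → ℝ) : Euc n → ℝ :=
  fun x => fderiv ℝ f x (EuclideanSpace.single i 1)

/-- Kronecker delta. -/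
def kd {n : ℕ} (i k : Fin n) : ℝ := if i = k then 1 else 0

/-- The tensor `A_{ik}` associated to a symmetric two-tensor field `H`. -/
def Aop {n : ℕ} (H : Fin n → Fin n → Euc n → ℝ) (i k : Fin n) : Euc n → ℝ :=
  fun x =>
    (∑ m, pd i (pd m (H m k)) x) + (∑ m, pd m (pd k (H i m)) x)
      - (∑ m, pd m (pd m (H i k)) x)
      - (1 / ((n : ℝ) - 1)) * (∑ m, ∑ p, pd m (pd p (H m p)) x) * kd i k

/-- The tensor `Z_{ijkl}` associated to a symmetric two-tensor field `H`. -/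
def Zop {n : ℕ} (H : Fin n → Fin n → Euc n → ℝ) (i j k l : Fin n) : Euc n → ℝ :=
  fun x =>
    pd i (pd k (H j l)) x - pd i (pd l (H j k)) x - pd j (pd k (H i l)) x
      + pd j (pd l (H i k)) x
      + (1 / ((n : ℝ) - 2)) * (Aop H j l x * kd i k - Aop H j k x * kd i l
          - Aop H i l x * kd j k + Aop H i k x * kd j l)

/-- The finite set of multi-indices `α` with `2 ≤ |α| ≤ d`. -/
def MIdx (n d : ℕ) : Finset (Fin n → ℕ) :=
  (Fintype.piFinset fun _ : Fin n => Finset.range (d + 1)).filter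
    fun α => 2 ≤ ∑ i, α i ∧ ∑ i, α i ≤ d

/-- `A_{in}(x) = 0` for all `x ∈ ∂ℝ^n_+` and all `i ∈ {1,…,n-1}`. -/
theorem statement1 (n : ℕ) (hn : 6 ≤ n) (l₀ : Fin n) (hl₀ : (l₀ : ℕ) = n - 1)
    (d : ℕ) (hd : d = (n - 2) / 2)
    (h : Fin n → Fin n → (Fin n → ℕ) → ℝ)
    (H : Fin n → Fin n → Euc n → ℝ)
    (hHdef : ∀ i k x, H i k x = ∑ α ∈ MIdx n d, h i k α * ∏ m, x m ^ α m)
    (hsymm : ∀ i k x, H i k x = H k i x)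
    (htrace : ∀ x, ∑ i, H i i x = 0)
    (hH1 : ∀ x : Euc n, 0 ≤ x l₀ → ∀ i, H i l₀ x = 0)
    (hH2 : ∀ x : Euc n, x l₀ = 0 → ∀ i, ∑ k, H i k x * x k = 0)
    (hH3 : ∀ x : Euc n, x l₀ = 0 → ∀ i k, pd l₀ (H i k) x = 0) :
    ∀ x : Euc n, x l₀ = 0 → ∀ i, i ≠ l₀ → Aop H i l₀ x = 0 := by
  have hz : ∀ i, H i l₀ = fun _ => (0:ℝ) := by
    intro i
    have ha : AnalyticOnNhd ℝ (H i l₀) Set.univ := by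
      have : H i l₀ = fun x => ∑ α ∈ MIdx n d, h i l₀ α * ∏ m, x m ^ α m := by
        funext x
        exact hHdef i l₀ x
      rw [this]
      intro x _
      apply Finset.analyticAt_fun_sum
      intro α _
      apply AnalyticAt.mul analyticAt_const
      apply Finset.analyticAt_fun_prod
      intro m _
      apply AnalyticAt.pow
      exact (EuclideanSpace.proj m : Euc n →L[ℝ] ℝ).analyticAt x
    have hb : AnalyticOnNhd ℝ (fun _ : Euc n => (0:ℝ)) Set.univ := fun x _ => analyticAt_const
    refine ha.eq_of_eventuallyEq hb (z₀ := EuclideanSpace.single l₀ 1) ?_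
    have ho : IsOpen {x : Euc n | 0 < x l₀} :=
      isOpen_lt continuous_const (EuclideanSpace.proj l₀ : Euc n →L[ℝ] ℝ).continuous
    filter_upwards [ho.mem_nhds (by simp : EuclideanSpace.single l₀ 1 ∈ {x : Euc n | 0 < x l₀})] with x hx
    exact hH1 x (le_of_lt hx) i
  have h0 : ∀ i : Fin n, pd i (fun _ : Euc n => (0:ℝ)) = fun _ => 0 := by
    intro i
    funext x
    simp [pd]
  intro x hx i hi
  have h2 : ∀ m, pd m (pd l₀ (H i m)) x = 0 := by
    intro m
    by_cases hm : m = l₀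
    · subst hm
      rw [hz, h0, h0]
    · by_cases hd : DifferentiableAt ℝ (pd l₀ (H i m)) x
      · rw [pd, ← hd.lineDeriv_eq_fderiv, lineDeriv]
        have : (fun t : ℝ => pd l₀ (H i m) (x + t • EuclideanSpace.single m 1)) = fun _ => 0 := by
          funext t
          apply hH3
          simp [hx, Ne.symm hm]
        rw [this]
        simp
      · rw [pd, fderiv_zero_of_not_differentiableAt hd]
        simp
  simp [Aop, hz, h0, h2, kd, hi]
end
end

section
/- Assume that Z_{ijkl}(x) = 0 for all points x ∈ ∂ℝ^n_+ and all indices i,j,k,l ∈ {1,…,n}. Then H_{ik}(x) = 0 and A_{ik}(x) = 0 for all x ∈ ∂ℝ^n_+ and all i,k ∈ {1,…,n−1}. -/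
noncomputable section

open MeasureTheory Metric

set_option linter.all false

section core
open MvPolynomial Finset
variable {σ : Type*} [Fintype σ] [DecidableEq σ]

theorem coeff_pderiv_aux (i : σ) (p : MvPolynomial σ ℝ) (α : σ →₀ ℕ) :
    coeff α (pderiv i p) = ((α i : ℝ) + 1) * coeff (α + Finsupp.single i 1) p := by
  induction p using MvPolynomial.induction_on' with
  | monomial u a =>
    rw [pderiv_monomial, coeff_monomial, coeff_monomial]
    by_cases hu : u i = 0
    · have h1 : u ≠ α + Finsupp.single i 1 := by
        intro h; rw [h] at hu; simp at hu
      simp [hu, h1]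
    · have h2 : u - Finsupp.single i 1 + Finsupp.single i 1 = u := by
        ext j
        by_cases hj : i = j
        · subst hj; simp; omega
        · simp [Finsupp.single_apply, hj]
      by_cases h3 : u - Finsupp.single i 1 = α
      · have h4 : u = α + Finsupp.single i 1 := by rw [← h3, h2]
        rw [if_pos h3, if_pos h4]
        rw [h4]; simp; ring
      · have h4 : u ≠ α + Finsupp.single i 1 := by
          intro h; apply h3; rw [h]; simp
        rw [if_neg h3, if_neg h4]; ring
  | add p q hp hq => simp [hp, hq]; ring

/-- Fischer pairing -/
def fis : MvPolynomial σ ℝ →ₗ[ℝ] MvPolynomial σ ℝ →ₗ[ℝ] ℝ :=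
  (basisMonomials σ ℝ).constr ℝ
    (fun α => ((∏ i, (Nat.factorial (α i) : ℝ)) • lcoeff ℝ α))

theorem fis_monomial (α : σ →₀ ℕ) (q : MvPolynomial σ ℝ) :
    fis (monomial α 1) q = (∏ i, (Nat.factorial (α i) : ℝ)) * coeff α q := by
  have := (basisMonomials σ ℝ).constr_basis ℝ
    (fun α => ((∏ i, (Nat.factorial (α i) : ℝ)) • lcoeff ℝ α)) α
  rw [coe_basisMonomials] at this
  unfold fis
  rw [this]; simp

theorem fis_eq (p q : MvPolynomial σ ℝ) :
    fis p q = ∑ α ∈ p.support, coeff α p * ((∏ i, (Nat.factorial (α i) : ℝ)) * coeff α q) := by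
  conv_lhs => rw [p.as_sum]
  rw [map_sum, LinearMap.sum_apply]
  refine Finset.sum_congr rfl fun α _ => ?_
  rw [show monomial α (coeff α p) = coeff α p • monomial α (1:ℝ) by simp [smul_monomial],
    map_smul, LinearMap.smul_apply, fis_monomial, smul_eq_mul]

theorem fis_nonneg (p : MvPolynomial σ ℝ) : 0 ≤ fis p p := by
  rw [fis_eq]
  refine Finset.sum_nonneg fun α _ => ?_
  have : 0 ≤ (∏ i, (Nat.factorial (α i) : ℝ)) := by positivity
  nlinarith [mul_nonneg this (sq_nonneg (coeff α p))]

theorem fis_pos (p : MvPolynomial σ ℝ) (h : fis p p ≤ 0) : p = 0 := by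
  by_contra hp
  obtain ⟨α, hα⟩ := Finset.nonempty_iff_ne_empty.2 (fun h => hp (support_eq_empty.1 h))
  apply absurd h
  rw [not_le, fis_eq]
  refine Finset.sum_pos (fun α hα => ?_) ⟨α, hα⟩
  have h1 : 0 < (∏ i, (Nat.factorial (α i) : ℝ)) :=
    Finset.prod_pos fun i _ => by exact_mod_cast Nat.factorial_pos _
  have h2 : 0 < coeff α p ^ 2 := by
    have := mem_support_iff.1 hα
    positivity
  nlinarith [mul_pos h1 h2]

theorem fis_symm (p q : MvPolynomial σ ℝ) : fis p q = fis q p := by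
  have key : ∀ p q : MvPolynomial σ ℝ, fis p q = ∑ α ∈ p.support ∪ q.support,
      coeff α p * ((∏ i, (Nat.factorial (α i) : ℝ)) * coeff α q) := by
    intro p q
    rw [fis_eq]
    refine Finset.sum_subset Finset.subset_union_left fun α _ h => ?_
    rw [notMem_support_iff.1 h, zero_mul]
  rw [key p q, key q p, Finset.union_comm]
  refine Finset.sum_congr rfl fun α _ => by ring

theorem fis_X_mul (i : σ) (p q : MvPolynomial σ ℝ) : fis (X i * p) q = fis p (pderiv i q) := by
  rw [p.as_sum, Finset.mul_sum, map_sum, map_sum, LinearMap.sum_apply, LinearMap.sum_apply]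
  refine Finset.sum_congr rfl fun α _ => ?_
  rw [show monomial α (coeff α p) = coeff α p • monomial α (1:ℝ) by simp [smul_monomial],
    mul_smul_comm, map_smul, map_smul, LinearMap.smul_apply, LinearMap.smul_apply]
  congr 1
  rw [show X i * monomial α (1:ℝ) = monomial (α + Finsupp.single i 1) 1 by
    rw [X, monomial_mul, add_comm, one_mul]]
  rw [fis_monomial, fis_monomial, coeff_pderiv_aux, ← mul_assoc]
  congr 1
  rw [← Finset.mul_prod_erase _ _ (Finset.mem_univ i),
    ← Finset.mul_prod_erase Finset.univ (fun j => (Nat.factorial (α j) : ℝ)) (Finset.mem_univ i)]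
  have : ∏ x ∈ univ.erase i, (Nat.factorial ((α + Finsupp.single i 1 : σ →₀ ℕ) x) : ℝ)
      = ∏ x ∈ univ.erase i, (Nat.factorial (α x) : ℝ) := by
    refine Finset.prod_congr rfl fun j hj => ?_
    have : i ≠ j := fun h => (Finset.ne_of_mem_erase hj) h.symm
    simp [Finsupp.single_apply, this]
  rw [this]
  simp [Nat.factorial_succ]
  ring

/-- Euler operator -/
def eul (p : MvPolynomial σ ℝ) : MvPolynomial σ ℝ := ∑ i, X i * pderiv i p

theorem eul_add (p q : MvPolynomial σ ℝ) : eul (p + q) = eul p + eul q := by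
  simp [eul, mul_add, Finset.sum_add_distrib]
theorem eul_zero : eul (0 : MvPolynomial σ ℝ) = 0 := by simp [eul]
theorem eul_sum {ι : Type*} (s : Finset ι) (f : ι → MvPolynomial σ ℝ) :
    eul (∑ i ∈ s, f i) = ∑ i ∈ s, eul (f i) := by
  simp only [eul, map_sum, Finset.mul_sum]
  rw [Finset.sum_comm]
theorem eul_mul (p q : MvPolynomial σ ℝ) : eul (p * q) = eul p * q + p * eul q := by
  simp only [eul, Derivation.leibniz, smul_eq_mul, Finset.sum_mul, Finset.mul_sum]
  rw [← Finset.sum_add_distrib]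
  exact Finset.sum_congr rfl fun i _ => by ring
theorem sum_X_pderiv_X (i : σ) (f : σ → MvPolynomial σ ℝ) :
    ∑ k, pderiv i (X k : MvPolynomial σ ℝ) * f k = f i := by
  rw [Finset.sum_eq_single i]
  · simp
  · intro b _ hb; rw [pderiv_X_of_ne hb, zero_mul]
  · simp
theorem eul_X (i : σ) : eul (X i : MvPolynomial σ ℝ) = X i := by
  rw [eul, Finset.sum_eq_single i]
  · simp
  · intro b _ hb; rw [pderiv_X_of_ne (Ne.symm hb), mul_zero]
  · simp
theorem pderiv_swap (i j : σ) (p : MvPolynomial σ ℝ) :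
    pderiv i (pderiv j p) = pderiv j (pderiv i p) := by
  ext α
  simp only [coeff_pderiv_aux]
  by_cases h : i = j
  · subst h; rfl
  · rw [add_right_comm]
    simp [Finsupp.single_apply, h, Ne.symm h]
    ring
/-- derivative of a radial sum -/
theorem pderiv_sum_X_mul (i : σ) (f : σ → MvPolynomial σ ℝ) :
    pderiv i (∑ k, X k * f k) = f i + ∑ k, X k * pderiv i (f k) := by
  simp only [map_sum, Derivation.leibniz, smul_eq_mul, Finset.sum_add_distrib]
  rw [add_comm]
  congr 1
  rw [← sum_X_pderiv_X i f]
  exact Finset.sum_congr rfl fun _ _ => mul_comm _ _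
theorem eul_sum_X_mul (f : σ → MvPolynomial σ ℝ) :
    eul (∑ k, X k * f k) = ∑ k, X k * f k + ∑ k, X k * eul (f k) := by
  simp only [eul_sum, eul_mul, eul_X, Finset.sum_add_distrib]
theorem pderiv_eul (i : σ) (p : MvPolynomial σ ℝ) :
    pderiv i (eul p) = pderiv i p + eul (pderiv i p) := by
  rw [eul, pderiv_sum_X_mul, eul]
  simp only [pderiv_swap i]

theorem fis_eul (p q : MvPolynomial σ ℝ) : fis (eul p) q = ∑ i, fis (pderiv i p) (pderiv i q) := by
  rw [eul, map_sum, LinearMap.sum_apply]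
  exact Finset.sum_congr rfl fun i _ => fis_X_mul _ _ _
theorem fis_eul_nonneg (p : MvPolynomial σ ℝ) : 0 ≤ fis (eul p) p := by
  rw [fis_eul]; exact Finset.sum_nonneg fun i _ => fis_nonneg _
theorem fis_eul_symm (p q : MvPolynomial σ ℝ) : fis (eul p) q = fis p (eul q) := by
  rw [fis_symm p, fis_eul, fis_eul]
  exact Finset.sum_congr rfl fun i _ => fis_symm _ _
theorem eul_add_one_inj (p : MvPolynomial σ ℝ) (h : eul p + p = 0) : p = 0 := by
  apply fis_pos
  have h1 : fis (eul p + p) p = 0 := by rw [h]; simp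
  rw [map_add, LinearMap.add_apply] at h1
  linarith [fis_eul_nonneg p]
theorem eul_inj_pderiv (p : MvPolynomial σ ℝ) (h : eul p = 0) (i : σ) : pderiv i p = 0 := by
  apply fis_pos
  have h1 : fis (eul p) p = 0 := by rw [h]; simp
  rw [fis_eul] at h1
  exact le_of_eq ((Finset.sum_eq_zero_iff_of_nonneg fun i _ => fis_nonneg _).1 h1 i (mem_univ i))

theorem cotton (hc : 4 ≤ Fintype.card σ) (h P : σ → σ → MvPolynomial σ ℝ)
    (hP : ∀ a b, P a b = P b a)
    (hZ : ∀ a b c d, pderiv a (pderiv c (h b d)) - pderiv a (pderiv d (h b c))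
      - pderiv b (pderiv c (h a d)) + pderiv b (pderiv d (h a c))
      + (P b d * (if a = c then 1 else 0) - P b c * (if a = d then 1 else 0)
        - P a d * (if b = c then 1 else 0) + P a c * (if b = d then 1 else 0)) = 0)
    (e b d : σ) : pderiv e (P b d) = pderiv b (P e d) := by
  have exi : ∀ s : Finset σ, s.card < 4 → ∃ a, a ∉ s := by
    intro s hs
    by_contra! hcon
    have : s = univ := by ext a; simp [hcon a]
    rw [this, card_univ] at hs; omega
  have pif : ∀ (i : σ) (p : MvPolynomial σ ℝ) (c : Prop) [Decidable c],
      pderiv i (p * (if c then 1 else 0)) = pderiv i p * (if c then 1 else 0) := by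
    intro i p c _; split_ifs <;> simp
  have bian : ∀ e b d a, a ≠ e → a ≠ b → a ≠ d →
      pderiv e (P b d) - pderiv b (P e d) + (pderiv e (P a a) - pderiv a (P e a)) * (if b = d then 1 else 0)
       - (pderiv b (P a a) - pderiv a (P b a)) * (if e = d then 1 else 0) = 0 := by
    intro e b d a h1 h2 h3
    have z1 := congrArg (pderiv e) (hZ a b a d)
    have z2 := congrArg (pderiv a) (hZ b e a d)
    have z3 := congrArg (pderiv b) (hZ e a a d)
    simp only [map_add, map_sub, pif, map_zero] at z1 z2 z3
    simp only [if_true, h1.symm, h2.symm, h3, if_false, mul_zero, mul_one] at z1 z2 z3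
    have s1 : ∀ p : MvPolynomial σ ℝ, pderiv e (pderiv a p) = pderiv a (pderiv e p) := pderiv_swap e a
    have s2 : ∀ p : MvPolynomial σ ℝ, pderiv b (pderiv a p) = pderiv a (pderiv b p) := pderiv_swap b a
    have s3 : ∀ p : MvPolynomial σ ℝ, pderiv e (pderiv b p) = pderiv b (pderiv e p) := pderiv_swap e b
    have s4 : ∀ i, ∀ p : MvPolynomial σ ℝ, pderiv i (pderiv d p) = pderiv d (pderiv i p) := fun i => pderiv_swap i d
    simp only [s1, s2, s3, s4] at z1 z2 z3
    linear_combination z1 + z2 + z3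
  have diag : ∀ e b, e ≠ b → pderiv e (P b b) = pderiv b (P e b) := by
    intro e b heb
    obtain ⟨a, ha⟩ := exi {e, b} (lt_of_le_of_lt (card_le_two) (by norm_num))
    obtain ⟨c, hcc⟩ := exi {e, b, a} (lt_of_le_of_lt (card_le_three) (by norm_num))
    simp only [mem_insert, mem_singleton, not_or] at ha hcc
    have b1 := bian e b b a ha.1 ha.2 ha.2
    have b2 := bian e b b c hcc.1 hcc.2.1 hcc.2.1
    have b3 := bian e a a c hcc.1 hcc.2.2 hcc.2.2
    simp only [if_true, heb, Ne.symm ha.1, if_false] at b1 b2 b3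
    have : (2 : MvPolynomial σ ℝ) * (pderiv e (P b b) - pderiv b (P e b)) = 0 := by
      linear_combination b1 + b2 - b3
    have h2 := (mul_eq_zero.1 this).resolve_left two_ne_zero
    exact sub_eq_zero.1 h2
  by_cases heb : e = b
  · rw [heb]
  by_cases hbd : b = d
  · subst hbd; exact diag e b heb
  by_cases hed : e = d
  · subst hed; exact (diag b e (Ne.symm heb)).symm
  obtain ⟨a, ha⟩ := exi {e, b, d} (lt_of_le_of_lt (card_le_three) (by norm_num))
  simp only [mem_insert, mem_singleton, not_or] at ha
  have b1 := bian e b d a ha.1 ha.2.1 ha.2.2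
  simp only [hbd, hed, if_false] at b1
  linear_combination b1

theorem radial (h P : σ → σ → MvPolynomial σ ℝ)
    (hP : ∀ a b, P a b = P b a) (hs : ∀ a b, h a b = h b a)
    (hx : ∀ a, ∑ k, X k * h a k = 0)
    (hZ : ∀ a b c d, pderiv a (pderiv c (h b d)) - pderiv a (pderiv d (h b c))
      - pderiv b (pderiv c (h a d)) + pderiv b (pderiv d (h a c))
      + (P b d * (if a = c then 1 else 0) - P b c * (if a = d then 1 else 0)
        - P a d * (if b = c then 1 else 0) + P a c * (if b = d then 1 else 0)) = 0)
    (a c : σ) :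
    eul (eul (h a c)) + eul (h a c)
      + ((∑ b, X b * ∑ d, X d * P b d) * (if a = c then 1 else 0)
        - X a * (∑ b, X b * P b c) - X c * (∑ b, X b * P a b) + (∑ b, X b * X b) * P a c) = 0 := by
  have r1 : ∀ b c, ∑ d, X d * pderiv c (h b d) = - h b c := by
    intro b c
    have := congrArg (pderiv c) (hx b)
    rw [pderiv_sum_X_mul, map_zero] at this
    linear_combination this
  have r1' : ∀ b c, ∑ d, X d * pderiv c (h d b) = - h b c := by
    intro b c; rw [← r1]; simp only [hs _ b]
  have r2 : ∀ a b c, ∑ d, X d * pderiv a (pderiv c (h b d)) = - pderiv a (h b c) - pderiv c (h b a) := by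
    intro a b c
    have := congrArg (pderiv a) (r1 b c)
    rw [pderiv_sum_X_mul, map_neg] at this
    linear_combination this
  have r3 : ∑ b, X b * ∑ d, X d * pderiv a (pderiv c (h b d)) = 2 * h a c := by
    simp only [r2, mul_sub, mul_neg, Finset.sum_sub_distrib, Finset.sum_neg_distrib, r1']
    rw [hs c a]; ring
  have e1 : ∀ a (p : MvPolynomial σ ℝ), ∑ d, X d * pderiv a (pderiv d p) = pderiv a (eul p) - pderiv a p := by
    intro a p
    have := pderiv_sum_X_mul a (fun k => pderiv k p)
    rw [eul]; linear_combination -this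
  have e2 : ∀ a c, ∑ b, X b * pderiv a (eul (h c b)) = - eul (h c a) := by
    intro a c
    have h1 := eul_sum_X_mul (fun b => h c b)
    rw [hx, eul_zero, zero_add] at h1
    have := congrArg (pderiv a) h1
    rw [pderiv_sum_X_mul, map_zero] at this
    linear_combination -this
  have T2 : ∑ b, X b * ∑ d, X d * pderiv a (pderiv d (h b c)) = h a c - eul (h a c) := by
    simp only [e1, mul_sub, Finset.sum_sub_distrib, r1', hs _ c, e2, r1]
    ring
  have T3 : ∑ b, X b * ∑ d, X d * pderiv b (pderiv c (h a d)) = h a c - eul (h a c) := by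
    simp only [Finset.mul_sum]
    rw [Finset.sum_comm]
    have : ∀ y x, X x * (X y * pderiv x (pderiv c (h a y)))
       = X y * (X x * pderiv c (pderiv x (h a y)) : MvPolynomial σ ℝ) := by
      intro y x; rw [pderiv_swap]; ring
    simp only [this]
    simp only [← Finset.mul_sum, e1, mul_sub, Finset.sum_sub_distrib, r1, e2]
    ring
  have T4 : ∑ b, X b * ∑ d, X d * pderiv b (pderiv d (h a c)) = eul (eul (h a c)) - eul (h a c) := by
    simp only [e1, mul_sub, Finset.sum_sub_distrib]
    rfl
  have Z : ∑ b, X b * ∑ d, X d * (pderiv a (pderiv c (h b d)) - pderiv a (pderiv d (h b c))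
      - pderiv b (pderiv c (h a d)) + pderiv b (pderiv d (h a c))
      + (P b d * (if a = c then 1 else 0) - P b c * (if a = d then 1 else 0)
        - P a d * (if b = c then 1 else 0) + P a c * (if b = d then 1 else 0))) = 0 := by
    simp only [hZ, mul_zero, Finset.sum_const_zero]
  simp only [mul_add, mul_sub, Finset.sum_add_distrib, Finset.sum_sub_distrib, r3, T2, T3, T4] at Z
  have p1 : ∑ b, X b * ∑ d, X d * (P b d * (if a = c then 1 else 0))
      = (∑ b, X b * ∑ d, X d * P b d) * (if a = c then 1 else 0) := by
    split_ifs <;> simp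
  have p2 : ∑ b, X b * ∑ d, X d * (P b c * (if a = d then 1 else 0)) = X a * (∑ b, X b * P b c) := by
    simp [Finset.mul_sum]
    exact Finset.sum_congr rfl fun _ _ => by ring
  have p3 : ∑ b, X b * ∑ d, X d * (P a d * (if b = c then 1 else 0)) = X c * (∑ b, X b * P a b) := by
    rw [Finset.sum_eq_single c]
    · simp
    · intro b _ hb; simp [hb]
    · simp
  have p4 : ∑ b, X b * ∑ d, X d * (P a c * (if b = d then 1 else 0)) = (∑ b, X b * X b) * P a c := by
    simp [Finset.sum_mul, mul_assoc]
  rw [p1, p2, p3, p4] at Z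
  linear_combination Z

theorem t_zero (m : ℝ) (hm : 2 ≤ m) (t : MvPolynomial σ ℝ) 
    (h : C (m - 2) * (eul (eul t) + C 3 * eul t + C 2 * t) + C (2 * m) * t + C 4 * eul t
      + (∑ b, X b * X b) * (∑ b, pderiv b (pderiv b t)) = 0) : t = 0 := by
  apply fis_pos
  have h1 := congrArg (fun p => fis p t) h
  have hr : ∀ p : MvPolynomial σ ℝ, fis ((∑ b, X b * X b) * p) t
     = fis p (∑ b, pderiv b (pderiv b t)) := by
    intro p
    simp only [Finset.sum_mul, map_sum, LinearMap.sum_apply, mul_assoc, fis_X_mul]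
  simp only [map_add, LinearMap.add_apply, ← smul_eq_C_mul, map_smul, LinearMap.smul_apply, hr, map_zero, LinearMap.zero_apply, smul_eq_mul] at h1
  have a1 := fis_nonneg (∑ b, pderiv b (pderiv b t))
  have a2 : 0 ≤ fis (eul (eul t)) t := by rw [fis_eul_symm]; exact fis_nonneg _
  have a3 := fis_eul_nonneg t
  have a4 := fis_nonneg t
  have : 0 ≤ (m-2) * (fis (eul (eul t)) t + 3 * fis (eul t) t + 2 * fis t t) := by
    apply mul_nonneg <;> linarith
  nlinarith

theorem core (hc : 4 ≤ Fintype.card σ) (h P : σ → σ → MvPolynomial σ ℝ)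
    (hP : ∀ a b, P a b = P b a) (hs : ∀ a b, h a b = h b a)
    (htr : ∑ a, h a a = 0)
    (hx : ∀ a, ∑ k, X k * h a k = 0)
    (hZ : ∀ a b c d, pderiv a (pderiv c (h b d)) - pderiv a (pderiv d (h b c))
      - pderiv b (pderiv c (h a d)) + pderiv b (pderiv d (h a c))
      + (P b d * (if a = c then 1 else 0) - P b c * (if a = d then 1 else 0)
        - P a d * (if b = c then 1 else 0) + P a c * (if b = d then 1 else 0)) = 0)
    (a c : σ) : h a c = 0 ∧ P a c = 0 := by
  have cot := cotton hc h P hP hZ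
  have rad := radial h P hP hs hx hZ
  set m : ℝ := (Fintype.card σ : ℝ) with hm
  have hm4 : (4:ℝ) ≤ m := by rw [hm]; exact_mod_cast hc
  set v : σ → MvPolynomial σ ℝ := fun b => ∑ d, X d * P b d with hv
  set s := ∑ b, X b * v b with hsd
  set t := ∑ b, P b b with ht
  set r2 : MvPolynomial σ ℝ := ∑ b, X b * X b with hr2
  have dv : ∀ b c, pderiv c (v b) = P b c + eul (P b c) := by
    intro b c
    rw [hv, pderiv_sum_X_mul, eul]
    congr 1
    refine Finset.sum_congr rfl fun d _ => ?_
    rw [hP b d, cot c d b, hP c b]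
  have ds : ∀ c, pderiv c s = C 2 * v c + eul (v c) - v c := by
    intro c
    rw [hsd, pderiv_sum_X_mul]
    have : ∑ k, X k * pderiv c (v k) = eul (v c) := by
      rw [eul]
      refine Finset.sum_congr rfl fun d _ => ?_
      rw [dv, dv, hP d c]
    rw [this, show (C 2 : MvPolynomial σ ℝ) = 2 from rfl]; ring
  have rad' : ∀ a c, eul (eul (h a c)) + eul (h a c)
      + (s * (if a = c then 1 else 0) - X a * v c - X c * v a + r2 * P a c) = 0 := by
    intro a c
    have := rad a c
    simp only [hP _ c] at this ⊢
    exact this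
  have tr : C (m - 2) * s + r2 * t = 0 := by
    have : ∑ a, (eul (eul (h a a)) + eul (h a a)
      + (s - X a * v a - X a * v a + r2 * P a a)) = 0 := by
      refine Finset.sum_eq_zero fun a _ => ?_
      have := rad' a a
      rw [if_pos rfl, mul_one] at this
      exact this
    simp only [Finset.sum_add_distrib, Finset.sum_sub_distrib, ← eul_sum, htr, eul_zero,
      ← Finset.mul_sum] at this
    simp only [Finset.sum_const, card_univ, nsmul_eq_mul] at this
    rw [← hsd, ← ht] at this
    rw [hm, C_sub, show (C (Fintype.card σ : ℝ) : MvPolynomial σ ℝ) = (Fintype.card σ : MvPolynomial σ ℝ) by simp,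
      show (C 2 : MvPolynomial σ ℝ) = 2 from rfl]
    linear_combination this
  have div : ∑ c, pderiv c (v c) = t + eul t := by
    simp only [dv, Finset.sum_add_distrib, ← eul_sum]
    rfl
  have ds' : ∀ c, pderiv c s = v c + eul (v c) := by
    intro c; rw [ds, show (C 2 : MvPolynomial σ ℝ) = 2 from rfl]; ring
  have lap : ∑ c, pderiv c (pderiv c s) = eul (eul t) + C 3 * eul t + C 2 * t := by
    simp only [ds', map_add, pderiv_eul, Finset.sum_add_distrib, ← eul_sum, div, eul_add]
    rw [show (C 2 : MvPolynomial σ ℝ) = 2 from rfl, show (C 3 : MvPolynomial σ ℝ) = 3 from rfl]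
    ring
  have dr : ∀ b, pderiv b r2 = 2 * X b := by
    intro b
    rw [hr2, pderiv_sum_X_mul]
    have := sum_X_pderiv_X b (fun k => (X k : MvPolynomial σ ℝ))
    rw [Finset.sum_congr rfl fun k _ => mul_comm (X k) (pderiv b (X k)), this]; ring
  have lap2 : ∑ b, pderiv b (pderiv b (r2 * t)) = C (2 * m) * t + C 4 * eul t
      + r2 * ∑ b, pderiv b (pderiv b t) := by
    have : ∀ b, pderiv b (pderiv b (r2 * t)) = 2 * t + 4 * (X b * pderiv b t)
        + r2 * pderiv b (pderiv b t) := by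
      intro b
      have h2 : pderiv b (2 : MvPolynomial σ ℝ) = 0 := by
        rw [show (2 : MvPolynomial σ ℝ) = C 2 from rfl, pderiv_C]
      simp only [pderiv_mul, dr, map_add, pderiv_X_self, h2]
      ring
    simp only [this, Finset.sum_add_distrib, ← Finset.mul_sum]
    rw [Finset.sum_const, card_univ, nsmul_eq_mul, ← eul, C_mul, hm,
      show (C (Fintype.card σ : ℝ) : MvPolynomial σ ℝ) = (Fintype.card σ : MvPolynomial σ ℝ) by simp,
      show (C 2 : MvPolynomial σ ℝ) = 2 from rfl, show (C 4 : MvPolynomial σ ℝ) = 4 from rfl]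
    ring
  have t0 : t = 0 := by
    apply t_zero m (by linarith)
    have e := congrArg (fun p => ∑ b, pderiv b (pderiv b p)) tr
    simp only [map_add, pderiv_C_mul, Finset.sum_add_distrib, map_zero, Finset.sum_const_zero] at e
    rw [lap2, ← Finset.mul_sum, lap] at e
    linear_combination e
  have s0 : s = 0 := by
    rw [t0, mul_zero, add_zero] at tr
    refine (mul_eq_zero.1 tr).resolve_left ?_
    intro hC
    have := C_eq_zero.1 hC
    linarith
  have v0 : ∀ c, v c = 0 := by
    intro c
    apply eul_add_one_inj
    rw [add_comm, ← ds', s0, map_zero]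
  have P0 : ∀ a b, P a b = 0 := by
    intro a b
    apply eul_add_one_inj
    rw [add_comm, ← dv, v0, map_zero]
  have E0 : ∀ a b, eul (h a b) = 0 := by
    intro a b
    apply eul_add_one_inj
    have := rad' a b
    simpa [P0, v0, s0] using this
  refine ⟨?_, P0 a c⟩
  have := congrArg (pderiv c) (hx a)
  rw [pderiv_sum_X_mul, map_zero] at this
  simpa [eul_inj_pderiv _ (E0 _ _)] using this
end core

section bridge
open MvPolynomial

theorem pd_eval {n : ℕ} (i : Fin n) (p : MvPolynomial (Fin n) ℝ) :
    pd i (fun x : Euc n => eval (fun j => x j) p) = fun x : Euc n => eval (fun j => x j) (pderiv i p) := by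
  have key : ∀ p : MvPolynomial (Fin n) ℝ, ∀ x : Euc n,
      DifferentiableAt ℝ (fun x : Euc n => eval (fun j => x j) p) x ∧
      fderiv ℝ (fun x : Euc n => eval (fun j => x j) p) x (EuclideanSpace.single i 1)
        = eval (fun j => x j) (pderiv i p) := by
    intro p x
    have hX : ∀ j, HasFDerivAt (fun x : Euc n => x j) (EuclideanSpace.proj j : Euc n →L[ℝ] ℝ) x :=
      fun j => (EuclideanSpace.proj j : Euc n →L[ℝ] ℝ).hasFDerivAt
    induction p using MvPolynomial.induction_on with
    | C a => simp
    | add p q hp hq =>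
      simp only [map_add]
      refine ⟨hp.1.add hq.1, ?_⟩
      rw [fderiv_fun_add hp.1 hq.1, ContinuousLinearMap.add_apply, hp.2, hq.2]
    | mul_X p j hp =>
      simp only [map_mul, eval_X]
      refine ⟨hp.1.mul (hX j).differentiableAt, ?_⟩
      rw [fderiv_fun_mul hp.1 (hX j).differentiableAt, (hX j).fderiv]
      simp only [ContinuousLinearMap.add_apply, ContinuousLinearMap.smul_apply, hp.2, smul_eq_mul]
      rw [pderiv_mul]
      simp only [map_add, map_mul, eval_X, pderiv_X]
      by_cases hij : i = j
      · subst hij; simp; ring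
      · simp [Pi.single_apply, hij, Ne.symm hij]; ring
  funext x
  exact (key p x).2

/-- restriction to the boundary -/
def rst {n : ℕ} (l₀ : Fin n) : MvPolynomial (Fin n) ℝ →ₐ[ℝ] MvPolynomial {i : Fin n // i ≠ l₀} ℝ :=
  aeval (fun i => if h : i ≠ l₀ then X ⟨i, h⟩ else 0)

/-- extension of a boundary point -/
def ext0 {n : ℕ} (l₀ : Fin n) (y : {i : Fin n // i ≠ l₀} → ℝ) : Euc n :=
  WithLp.toLp 2 (fun i => if h : i ≠ l₀ then y ⟨i, h⟩ else 0)

theorem eval_rst {n : ℕ} (l₀ : Fin n) (y : {i : Fin n // i ≠ l₀} → ℝ) (p : MvPolynomial (Fin n) ℝ) :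
    eval y (rst l₀ p) = eval (fun j => ext0 l₀ y j) p := by
  induction p using MvPolynomial.induction_on with
  | C a => simp [rst]
  | add p q hp hq => simp [hp, hq]
  | mul_X p j hp =>
    rw [map_mul, map_mul, map_mul, hp, eval_X]
    congr 1
    simp only [rst, aeval_X, ext0]
    split_ifs <;> simp

theorem pderiv_rst {n : ℕ} (l₀ : Fin n) (a : {i : Fin n // i ≠ l₀}) (p : MvPolynomial (Fin n) ℝ) :
    pderiv a (rst l₀ p) = rst l₀ (pderiv a.1 p) := by
  induction p using MvPolynomial.induction_on with
  | C a => simp [rst]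
  | add p q hp hq => simp [hp, hq]
  | mul_X p j hp =>
    rw [map_mul, pderiv_mul, pderiv_mul, hp, map_add, map_mul, map_mul]
    congr 2
    simp only [rst, aeval_X]
    by_cases hj : j = l₀
    · subst hj; simp [pderiv_X, Pi.single_apply, Ne.symm a.2]
    · simp only [ne_eq, hj, not_false_eq_true, dite_true, pderiv_X, Pi.single_apply, Subtype.ext_iff]
      split_ifs <;> simp

/-- polynomial version of `Aop` -/
def APoly {n : ℕ} (G : Fin n → Fin n → MvPolynomial (Fin n) ℝ) (i k : Fin n) :
    MvPolynomial (Fin n) ℝ :=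
    (∑ m, pderiv i (pderiv m (G m k))) + (∑ m, pderiv m (pderiv k (G i m)))
      - (∑ m, pderiv m (pderiv m (G i k)))
      - C (1 / ((n : ℝ) - 1)) * (∑ m, ∑ p, pderiv m (pderiv p (G m p))) * C (kd i k)

theorem kd_symm {n : ℕ} (i k : Fin n) : kd i k = kd k i := by
  simp [kd, eq_comm]

theorem APoly_symm {n : ℕ} (G : Fin n → Fin n → MvPolynomial (Fin n) ℝ)
    (hG : ∀ i k, G i k = G k i) (i k : Fin n) : APoly G i k = APoly G k i := by
  unfold APoly
  rw [kd_symm k i, hG k i]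
  have h1 : ∑ m, pderiv m (pderiv k (G i m)) = ∑ m, pderiv k (pderiv m (G m i)) :=
    Finset.sum_congr rfl fun m _ => by rw [pderiv_swap, hG]
  have h2 : ∑ m, pderiv m (pderiv i (G k m)) = ∑ m, pderiv i (pderiv m (G m k)) :=
    Finset.sum_congr rfl fun m _ => by rw [pderiv_swap, hG]
  rw [h1, h2]; ring

theorem Aop_eval {n : ℕ} (G : Fin n → Fin n → MvPolynomial (Fin n) ℝ) (H : Fin n → Fin n → Euc n → ℝ)
    (hGH : ∀ i k, H i k = fun x : Euc n => eval (fun j => x j) (G i k)) (i k : Fin n) (x : Euc n) :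
    Aop H i k x = eval (fun j => x j) (APoly G i k) := by
  simp only [Aop, APoly, hGH, pd_eval, map_add, map_sub, map_sum, map_mul, eval_C]

end bridge

/-- If `Z_{ijkl}(x) = 0` for all `x ∈ ∂ℝ^n_+` and all indices, then
`H_{ik}(x) = 0` and `A_{ik}(x) = 0` for all `x ∈ ∂ℝ^n_+` and all `i,k ∈ {1,…,n-1}`. -/
theorem statement2 (n : ℕ) (hn : 6 ≤ n) (l₀ : Fin n) (hl₀ : (l₀ : ℕ) = n - 1)
    (d : ℕ) (hd : d = (n - 2) / 2)
    (h : Fin n → Fin n → (Fin n → ℕ) → ℝ)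
    (H : Fin n → Fin n → Euc n → ℝ)
    (hHdef : ∀ i k x, H i k x = ∑ α ∈ MIdx n d, h i k α * ∏ m, x m ^ α m)
    (hsymm : ∀ i k x, H i k x = H k i x)
    (htrace : ∀ x, ∑ i, H i i x = 0)
    (hH1 : ∀ x : Euc n, 0 ≤ x l₀ → ∀ i, H i l₀ x = 0)
    (hH2 : ∀ x : Euc n, x l₀ = 0 → ∀ i, ∑ k, H i k x * x k = 0)
    (hH3 : ∀ x : Euc n, x l₀ = 0 → ∀ i k, pd l₀ (H i k) x = 0)
    (hZ : ∀ x : Euc n, x l₀ = 0 → ∀ i j k l, Zop H i j k l x = 0) :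
    ∀ x : Euc n, x l₀ = 0 → ∀ i k, i ≠ l₀ → k ≠ l₀ →
      H i k x = 0 ∧ Aop H i k x = 0 := by
  classical
  set G : Fin n → Fin n → MvPolynomial (Fin n) ℝ := fun i k =>
    ∑ α ∈ MIdx n d, MvPolynomial.monomial (Finsupp.equivFunOnFinite.symm α) (h i k α) with hG
  have hGH : ∀ i k, H i k = fun x : Euc n => MvPolynomial.eval (fun j => x j) (G i k) := by
    intro i k
    funext x
    rw [hHdef, hG]
    simp only [map_sum, MvPolynomial.eval_monomial]
    refine Finset.sum_congr rfl fun α _ => ?_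
    rw [Finsupp.prod_fintype _ _ (by simp)]
    simp
  have hGs : ∀ i k, G i k = G k i := by
    intro i k
    apply MvPolynomial.funext
    intro x
    have := hsymm i k (WithLp.toLp 2 x)
    rw [hGH, hGH] at this
    exact this
  clear_value G
  have hext : ∀ y, ext0 l₀ y l₀ = 0 := by intro y; simp [ext0]
  have hext' : ∀ y (a : {i : Fin n // i ≠ l₀}), ext0 l₀ y a = y a := by
    intro y a; simp [ext0, a.2]
  have hsum : ∀ f : Fin n → ℝ, f l₀ = 0 → ∑ i, f i = ∑ a : {i : Fin n // i ≠ l₀}, f a := by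
    intro f hf
    rw [← Finset.add_sum_erase _ _ (Finset.mem_univ l₀), hf, zero_add]
    exact Finset.sum_subtype _ (by simp) _
  have hcard : Fintype.card {i : Fin n // i ≠ l₀} = n - 1 := by
    rw [Fintype.card_subtype_compl]; simp
  have hn2 : (n : ℝ) - 2 ≠ 0 := by
    have : (6 : ℝ) ≤ n := by exact_mod_cast hn
    linarith
  have main := core (σ := {i : Fin n // i ≠ l₀}) (by omega) (fun a b => rst l₀ (G a b))
    (fun a b => MvPolynomial.C (1 / ((n : ℝ) - 2)) * rst l₀ (APoly G a b))
    (fun a b => by rw [APoly_symm G hGs]) (fun a b => by rw [hGs])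
    (by
      apply MvPolynomial.funext
      intro y
      simp only [map_sum, eval_rst, map_zero]
      have := htrace (ext0 l₀ y)
      rw [hsum _ (hH1 _ (hext y).ge _)] at this
      simpa only [hGH] using this)
    (by
      intro a
      apply MvPolynomial.funext
      intro y
      simp only [map_sum, map_mul, eval_rst, map_zero, MvPolynomial.eval_X]
      have := hH2 (ext0 l₀ y) (hext y) a
      rw [hsum _ (by rw [hext, mul_zero])] at this
      simp only [hGH, hext'] at this
      rw [← this]
      exact Finset.sum_congr rfl fun _ _ => mul_comm _ _)
    (by
      intro a b c d
      apply MvPolynomial.funext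
      intro y
      have := hZ (ext0 l₀ y) (hext y) a b c d
      simp only [Zop, Aop_eval G H hGH] at this
      simp only [hGH, pd_eval] at this
      simp only [pderiv_rst, map_add, map_sub, map_mul, eval_rst, MvPolynomial.eval_C, map_zero]
      have ke : ∀ a b : {i : Fin n // i ≠ l₀}, MvPolynomial.eval y (if a = b then 1 else 0)
          = kd a.1 b.1 := by
        intro a b
        simp only [kd, Subtype.ext_iff]
        split_ifs <;> simp
      simp only [ke]
      rw [← this]; ring)
  intro x hx i k hi hk
  obtain ⟨m1, m2⟩ := main ⟨i, hi⟩ ⟨k, hk⟩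
  have hxe : ext0 l₀ (fun a => x a.1) = x := by
    ext j
    simp only [ext0]
    split_ifs with hj
    · rfl
    · rw [not_not.1 hj, hx]
  constructor
  · have := congrArg (MvPolynomial.eval (fun a => x a.1)) m1
    rw [eval_rst, hxe] at this
    simpa [hGH] using this
  · have := congrArg (MvPolynomial.eval (fun a => x a.1)) m2
    rw [map_mul, eval_rst, hxe, MvPolynomial.eval_C, map_zero] at this
    rw [Aop_eval G H hGH]
    exact (mul_eq_zero.1 this).resolve_left (one_div_ne_zero hn2)
end
end

section
/- There exists a constant K₁ > 0, depending only on n, such that for every tensor H as in the context and every r > 0: Σ_{2 ≤ |α| ≤ d} Σ_{i,k=1}^n |h_{ik,α}|² r^{2|α|−4+n} ≤ K₁ ∫_{U_r} Σ_{i,j,k,l=1}^n |Z_{ijkl}(x)|² dx. -/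
noncomputable section

open MeasureTheory Metric

namespace S4
open MvPolynomial
set_option linter.unusedSimpArgs false

lemma C_two {τ : Type*} : (C (2:ℝ) : MvPolynomial τ ℝ) = 2 := map_ofNat C 2
lemma C_four {τ : Type*} : (C (4:ℝ) : MvPolynomial τ ℝ) = 4 := map_ofNat C 4

lemma pd_comm {τ : Type*} (i j : τ) (f : MvPolynomial τ ℝ) :
    pderiv i (pderiv j f) = pderiv j (pderiv i f) := by
  classical
  ext m
  simp only [coeff_pderiv]
  rw [add_right_comm]
  by_cases h : i = j
  · subst h; ring
  · simp [Finsupp.single_apply, h, Ne.symm h]; ring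

lemma hc_pderiv {τ : Type*} (i : τ) (m : ℕ) (f : MvPolynomial τ ℝ) :
    homogeneousComponent m (pderiv i f) = pderiv i (homogeneousComponent (m+1) f) := by
  ext a
  simp only [coeff_homogeneousComponent, coeff_pderiv]
  simp [map_add]

lemma hc_mul_X {τ : Type*} (i : τ) (m : ℕ) (f : MvPolynomial τ ℝ) :
    homogeneousComponent (m+1) (f * X i) = homogeneousComponent m f * X i := by
  classical
  ext a
  simp only [coeff_homogeneousComponent, coeff_mul_X']
  by_cases h : i ∈ a.support
  · simp only [h, if_true]
    have : a = (a - Finsupp.single i 1) + Finsupp.single i 1 := by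
      ext j; by_cases hj : i = j
      · subst hj; simp at h ⊢; omega
      · simp [Finsupp.single_apply, hj]
    have h2 : a.degree = (a - Finsupp.single i 1).degree + 1 := by
      conv_lhs => rw [this]
      simp [map_add]
    rw [h2]; simp
  · simp [h]

lemma pd_hom0 {τ : Type*} (i : τ) (f : MvPolynomial τ ℝ) (h : f.IsHomogeneous 0) :
    pderiv i f = 0 := by
  have := (totalDegree_zero_iff_isHomogeneous τ).2 h
  rw [totalDegree_eq_zero_iff_eq_C] at this
  rw [this]; simp

lemma pd_sum_mul_X {τ : Type*} [Fintype τ] [DecidableEq τ] (l : τ) (f : τ → MvPolynomial τ ℝ) :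
    pderiv l (∑ k, f k * X k) = (∑ k, pderiv l (f k) * X k) + f l := by
  simp only [map_sum, pderiv_mul, Finset.sum_add_distrib, pderiv_X, Pi.single_apply]
  simp

lemma euler {τ : Type*} [Fintype τ] {m : ℕ} {f : MvPolynomial τ ℝ} (h : f.IsHomogeneous m) :
    ∑ k, pderiv k f * X k = (m : MvPolynomial τ ℝ) * f := by
  have := h.sum_X_mul_pderiv
  simp only [nsmul_eq_mul] at this
  rw [← this]
  exact Finset.sum_congr rfl fun _ _ => mul_comm _ _

lemma lap_mul {τ : Type*} [Fintype τ] [DecidableEq τ] {m : ℕ} {f : MvPolynomial τ ℝ}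
    (h : f.IsHomogeneous m) :
    ∑ i, pderiv i (pderiv i ((∑ k, X k * X k) * f)) =
      (2 * (Fintype.card τ : MvPolynomial τ ℝ) + 4 * (m : MvPolynomial τ ℝ)) * f
        + (∑ k, X k * X k) * ∑ i, pderiv i (pderiv i f) := by
  have h1 : ∀ i, pderiv i (∑ k, X k * X k : MvPolynomial τ ℝ) = 2 * X i := by
    intro i
    rw [pd_sum_mul_X]
    simp [pderiv_X, Pi.single_apply]; ring
  have h2 : ∀ i, pderiv i (pderiv i ((∑ k, X k * X k) * f)) =
      2 * f + 4 * (pderiv i f * X i) + (∑ k, X k * X k) * pderiv i (pderiv i f) := by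
    intro i
    have h3 : pderiv i (2 * X i : MvPolynomial τ ℝ) = 2 := by
      rw [pderiv_mul]
      have : pderiv i (2 : MvPolynomial τ ℝ) = 0 := by
        rw [← C_two]; exact pderiv_C
      simp [this]
    rw [pderiv_mul, h1, map_add, pderiv_mul (f := 2 * X i), h3,
      pderiv_mul (f := ∑ k, X k * X k), h1]; ring
  simp only [h2, Finset.sum_add_distrib, ← Finset.mul_sum, euler h]
  simp; ring

lemma descent {τ : Type*} [Fintype τ] [DecidableEq τ] (m : ℕ) :
    ∀ (c : ℝ), 0 < c → ∀ q : MvPolynomial τ ℝ, q.IsHomogeneous m →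
      (∑ k, X k * X k) * ∑ i, pderiv i (pderiv i q) = - (C c * q) → q = 0 := by
  induction m using Nat.strong_induction_on with
  | _ m ih =>
  intro c hc q hq h
  have hl : (∑ i, pderiv i (pderiv i q)) = 0 := by
    by_cases hm : m ≤ 1
    · apply Finset.sum_eq_zero
      intro i _
      apply pd_hom0
      have := hq.pderiv (i := i)
      rwa [show m - 1 = 0 by omega] at this
    · set q1 := ∑ i, pderiv i (pderiv i q) with hq1
      have hh : q1.IsHomogeneous (m - 1 - 1) := by
        apply IsHomogeneous.sum
        intro i _
        exact (hq.pderiv (i := i)).pderiv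
      have key := lap_mul hh
      rw [h] at key
      have e : ∑ i, pderiv i (pderiv i (-(C c * q))) = - (C c * q1) := by
        simp only [map_neg, pderiv_C_mul, Finset.sum_neg_distrib, ← Finset.mul_sum, hq1]
      rw [e] at key
      refine ih (m - 1 - 1) (by omega) (c + (2 * (Fintype.card τ : ℝ) + 4 * ((m - 1 - 1 : ℕ) : ℝ)))
        (by positivity) q1 hh ?_
      simp only [map_add, map_mul, map_natCast]
      rw [C_two, C_four]
      linear_combination -key
  rw [hl, mul_zero, eq_comm, neg_eq_zero] at h
  rcases mul_eq_zero.1 h with h | h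
  · exact absurd (C_eq_zero.1 h) hc.ne'
  · exact h

/-- linear Riemann-type expression -/
noncomputable def Rm {τ : Type*} (G : τ → τ → MvPolynomial τ ℝ) (i j k l : τ) : MvPolynomial τ ℝ :=
  pderiv i (pderiv k (G j l)) - pderiv i (pderiv l (G j k)) - pderiv j (pderiv k (G i l))
    + pderiv j (pderiv l (G i k))

/-- Kulkarni--Nomizu with delta -/
def KN {τ R : Type*} [DecidableEq τ] [Ring R] (p : τ → τ → R) (i j k l : τ) : R :=
  (if i = k then p j l else 0) - (if i = l then p j k else 0) - (if j = k then p i l else 0)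
    + (if j = l then p i k else 0)

lemma bianchi {τ : Type*} (G : τ → τ → MvPolynomial τ ℝ) (e i j k l : τ) :
    pderiv e (Rm G i j k l) + pderiv i (Rm G j e k l) + pderiv j (Rm G e i k l) = 0 := by
  simp only [Rm, map_add, map_sub]
  rw [pd_comm i e (pderiv k _), pd_comm i e (pderiv l _), pd_comm j e (pderiv k _),
    pd_comm j e (pderiv l _), pd_comm j i (pderiv k _), pd_comm j i (pderiv l _)]
  ring

lemma exists_ne3 {τ : Type*} [Fintype τ] [DecidableEq τ] (hc : 4 ≤ Fintype.card τ) (a b c : τ) :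
    ∃ i, i ≠ a ∧ i ≠ b ∧ i ≠ c := by
  have : ({a, b, c} : Finset τ).card < Fintype.card τ :=
    lt_of_le_of_lt Finset.card_le_three (by omega)
  obtain ⟨i, hi⟩ := Finset.exists_mem_notMem_of_card_lt_card
    (s := ({a, b, c} : Finset τ)) (t := Finset.univ) (by simpa using this)
  refine ⟨i, ?_⟩
  simpa using hi.2

lemma cotton {τ : Type*} [Fintype τ] [DecidableEq τ] (hc : 4 ≤ Fintype.card τ)
    (G p : τ → τ → MvPolynomial τ ℝ) (h : ∀ i j k l, Rm G i j k l = KN p i j k l) (e j l : τ) :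
    pderiv e (p j l) = pderiv j (p e l) := by
  have B : ∀ e i j k l, pderiv e (KN p i j k l) + pderiv i (KN p j e k l)
      + pderiv j (KN p e i k l) = 0 := by
    intro e i j k l
    rw [← h, ← h, ← h]; exact bianchi G e i j k l
  -- three distinct indices
  have D1 : ∀ e j l, e ≠ j → l ≠ e → l ≠ j → pderiv e (p j l) = pderiv j (p e l) := by
    intro e j l h1 h2 h3
    obtain ⟨i, i1, i2, i3⟩ := exists_ne3 hc e j l
    have := B e i j i l
    simp [KN, h1, h2, h3, i1, i2, i3, h1.symm, h2.symm, h3.symm, i1.symm, i2.symm, i3.symm] at this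
    linear_combination this
  have D2 : ∀ e j i, e ≠ j → i ≠ e → i ≠ j → pderiv e (p j j) - pderiv j (p e j)
      + (pderiv e (p i i) - pderiv i (p e i)) = 0 := by
    intro e j i h1 i1 i2
    have := B e i j i j
    simp [KN, h1, i1, i2, h1.symm, i1.symm, i2.symm] at this
    linear_combination this
  have D3 : ∀ e j, e ≠ j → pderiv e (p j j) = pderiv j (p e j) := by
    intro e j h1
    obtain ⟨i, i1, i2, _⟩ := exists_ne3 hc e j j
    obtain ⟨k, k1, k2, k3⟩ := exists_ne3 hc e j i
    have a1 := D2 e j i h1 i1 i2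
    have a2 := D2 e j k h1 k1 k2
    have a3 := D2 e i k i1.symm k1 k3
    have : (2 : MvPolynomial τ ℝ) * (pderiv e (p j j) - pderiv j (p e j)) = 0 := by
      linear_combination a1 + a2 - a3
    rcases mul_eq_zero.1 this with h | h
    · exact absurd h two_ne_zero
    · exact sub_eq_zero.1 h
  by_cases h1 : e = j
  · rw [h1]
  by_cases h2 : l = e
  · subst h2; exact (D3 j l (Ne.symm h1)).symm
  by_cases h3 : l = j
  · subst h3; exact D3 e l h1
  exact D1 e j l h1 h2 h3

lemma Rm_contract {τ : Type*} [Fintype τ] [DecidableEq τ] (G : τ → τ → MvPolynomial τ ℝ) (m : ℕ)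
    (hG : ∀ i j, (G i j).IsHomogeneous m) (hs : ∀ i j, G i j = G j i)
    (hx : ∀ i, ∑ k, G i k * X k = 0) (j l : τ) :
    ∑ i, (∑ k, Rm G i j k l * X k) * X i = (m * (m + 1) : MvPolynomial τ ℝ) * G j l := by
  have e1 : ∀ l j, ∑ k, pderiv l (G j k) * X k = - G j l := by
    intro l j
    have := pd_sum_mul_X l (fun k => G j k)
    rw [hx j, map_zero] at this
    linear_combination -this
  have e2 : ∀ i l j, ∑ k, pderiv i (pderiv l (G j k)) * X k =
      - pderiv i (G j l) - pderiv l (G j i) := by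
    intro i l j
    have := pd_sum_mul_X i (fun k => pderiv l (G j k))
    rw [e1, map_neg] at this
    linear_combination -this
  have e3 : ∀ i j l, ∑ k, pderiv i (pderiv k (G j l)) * X k =
     (m : MvPolynomial τ ℝ) * pderiv i (G j l) - pderiv i (G j l) := by
    intro i j l
    have := pd_sum_mul_X i (fun k => pderiv k (G j l))
    rw [euler (hG j l), pderiv_mul] at this
    simp at this
    linear_combination -this
  have inner : ∀ i, ∑ k, Rm G i j k l * X k =
      (m : MvPolynomial τ ℝ) * pderiv i (G j l) - pderiv i (G j l)
      + pderiv i (G j l) + pderiv l (G j i)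
      - ((m : MvPolynomial τ ℝ) * pderiv j (G l i) - pderiv j (G l i))
      - pderiv j (G l i) - pderiv l (G j i) := by
    intro i
    simp only [Rm, add_mul, sub_mul, Finset.sum_add_distrib, Finset.sum_sub_distrib]
    rw [e3, e3, e2, e2, hs i l, hs i j]; ring
  have : ∀ i, (∑ k, Rm G i j k l * X k) * X i =
      (m : MvPolynomial τ ℝ) * (pderiv i (G j l) * X i) -
      (m : MvPolynomial τ ℝ) * (pderiv j (G l i) * X i) := by
    intro i; rw [inner]; ring
  simp only [this, Finset.sum_sub_distrib, ← Finset.mul_sum]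
  rw [euler (hG j l), e1, hs l j]; ring

lemma KN_contract {τ : Type*} [Fintype τ] [DecidableEq τ] (p : τ → τ → MvPolynomial τ ℝ)
    (hs : ∀ i j, p i j = p j i) (j l : τ) :
    ∑ i, (∑ k, KN p i j k l * X k) * X i = (∑ k, X k * X k) * p j l
      - (∑ k, p j k * X k) * X l - X j * (∑ k, p l k * X k)
      + if j = l then ∑ i, (∑ k, p i k * X k) * X i else 0 := by
  have inner : ∀ i, ∑ k, KN p i j k l * X k = p j l * X i
      - (if i = l then ∑ k, p j k * X k else 0) - p i l * X j
      + (if j = l then ∑ k, p i k * X k else 0) := by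
    intro i
    simp only [KN, add_mul, sub_mul, Finset.sum_add_distrib, Finset.sum_sub_distrib, ite_mul,
      zero_mul, Finset.sum_ite_eq, Finset.mem_univ, if_true]
    split_ifs <;> simp
  simp only [inner, add_mul, sub_mul, Finset.sum_add_distrib, Finset.sum_sub_distrib, ite_mul,
      zero_mul, Finset.sum_ite_eq', Finset.mem_univ, if_true]
  have a1 : ∑ x, p j l * X x * X x = (∑ k, X k * X k) * p j l := by
    rw [Finset.sum_mul]; exact Finset.sum_congr rfl fun _ _ => by ring
  have a2 : ∑ x, p x l * X j * X x = X j * (∑ k, p l k * X k) := by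
    rw [Finset.mul_sum]; exact Finset.sum_congr rfl fun x _ => by rw [hs x l]; ring
  rw [a1, a2]
  split_ifs <;> simp

lemma radial_hom {τ : Type*} [Fintype τ] [DecidableEq τ] (hc : 4 ≤ Fintype.card τ)
    (G p : τ → τ → MvPolynomial τ ℝ) (m : ℕ)
    (hG : ∀ i j, (G i j).IsHomogeneous (m+2)) (hp : ∀ i j, (p i j).IsHomogeneous m)
    (hGs : ∀ i j, G i j = G j i) (hps : ∀ i j, p i j = p j i)
    (hx : ∀ i, ∑ k, G i k * X k = 0) (ht : ∑ i, G i i = 0)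
    (h : ∀ i j k l, Rm G i j k l = KN p i j k l) (i j : τ) : G i j = 0 := by
  have co := cotton hc G p h
  set v : τ → MvPolynomial τ ℝ := fun i => ∑ k, p i k * X k with hv
  set q : MvPolynomial τ ℝ := ∑ i, v i * X i with hq
  have main : ∀ j l, ((m+2) * (m + 3) : MvPolynomial τ ℝ) * G j l =
      (∑ k, X k * X k) * p j l - v j * X l - X j * v l + if j = l then q else 0 := by
    intro j l
    have a := Rm_contract G (m+2) hG hGs hx j l
    simp only [h] at a
    rw [KN_contract p hps] at a
    push_cast at a
    linear_combination -a
  have dv : ∀ a b, pderiv a (v b) = (m+1 : MvPolynomial τ ℝ) * p a b := by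
    intro a b
    have e := pd_sum_mul_X a (fun k => p b k)
    have : ∑ k, pderiv a (p b k) * X k = ∑ k, pderiv k (p b a) * X k := by
      refine Finset.sum_congr rfl fun k _ => ?_
      rw [hps b k, co a k b, hps a b]
    rw [this, euler (hp b a)] at e
    simp only [hv]; rw [e, hps b a]; ring
  have dq : ∀ a, pderiv a q = (m+2 : MvPolynomial τ ℝ) * v a := by
    intro a
    rw [hq, pd_sum_mul_X]
    simp only [dv, mul_assoc, ← Finset.mul_sum]
    simp only [hv]; ring
  have tr : (∑ k, X k * X k) * ∑ i, p i i = - ((Fintype.card τ - 2 : MvPolynomial τ ℝ) * q) := by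
    have : ∑ j, ((m+2) * (m + 3) : MvPolynomial τ ℝ) * G j j = 0 := by
      rw [← Finset.mul_sum, ht, mul_zero]
    simp only [main, Finset.sum_add_distrib, Finset.sum_sub_distrib, ← Finset.mul_sum] at this
    have e : ∑ x, X x * v x = q := Finset.sum_congr rfl fun _ _ => mul_comm _ _
    rw [e, ← hq] at this
    simp at this
    linear_combination this
  have hqh : q.IsHomogeneous (m+1+1) := by
    apply IsHomogeneous.sum
    intro i _
    refine IsHomogeneous.mul (m := m+1) (n := 1) ?_ (isHomogeneous_X _ _)
    apply IsHomogeneous.sum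
    intro k _
    exact (hp i k).mul (isHomogeneous_X _ _)
  have n1 : ((m:MvPolynomial τ ℝ) + 1) ≠ 0 := by exact_mod_cast Nat.succ_ne_zero m
  have n2 : ((m:MvPolynomial τ ℝ) + 2) ≠ 0 := by exact_mod_cast Nat.succ_ne_zero (m+1)
  have n3 : ((m:MvPolynomial τ ℝ) + 3) ≠ 0 := by exact_mod_cast Nat.succ_ne_zero (m+2)
  have natD : ∀ (a : τ) (f : MvPolynomial τ ℝ), pderiv a ((m+2 : MvPolynomial τ ℝ) * f) =
      (m+2 : MvPolynomial τ ℝ) * pderiv a f := by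
    intro a f
    have : ((m:MvPolynomial τ ℝ) + 2) = C ((m:ℝ)+2) := by
      rw [map_add, C_two, map_natCast]
    rw [this, pderiv_C_mul]
  have q0 : q = 0 := by
    refine descent (m+1+1) (((m:ℝ)+2) * ((m:ℝ)+1) * ((Fintype.card τ : ℝ) - 2)) ?_ q hqh ?_
    · have : (4:ℝ) ≤ Fintype.card τ := by exact_mod_cast hc
      have : (0:ℝ) < (Fintype.card τ : ℝ) - 2 := by linarith
      positivity
    · simp only [dq, natD, dv, ← Finset.mul_sum]
      simp only [map_mul, map_sub, map_add, map_natCast, map_one, map_ofNat]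
      linear_combination (m+2 : MvPolynomial τ ℝ) * (m+1) * tr
  have v0 : ∀ a, v a = 0 := by
    intro a
    have := dq a
    rw [q0, map_zero, eq_comm] at this
    exact (mul_eq_zero.1 this).resolve_left n2
  have p0 : ∀ a b, p a b = 0 := by
    intro a b
    have := dv a b
    rw [v0, map_zero, eq_comm] at this
    exact (mul_eq_zero.1 this).resolve_left n1
  have := main i j
  simp [v0, p0, q0] at this
  rcases this with (h | h) | h
  · exact absurd h n2
  · exact absurd h n3
  · exact h

lemma radial {τ : Type*} [Fintype τ] [DecidableEq τ] (hc : 4 ≤ Fintype.card τ)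
    (G p : τ → τ → MvPolynomial τ ℝ)
    (hGs : ∀ i j, G i j = G j i) (hps : ∀ i j, p i j = p j i)
    (hx : ∀ i, ∑ k, G i k * X k = 0) (ht : ∑ i, G i i = 0)
    (h : ∀ i j k l, Rm G i j k l = KN p i j k l) (i j : τ) : G i j = 0 := by
  suffices H : ∀ m, homogeneousComponent m (G i j) = 0 by
    rw [← sum_homogeneousComponent (G i j)]
    exact Finset.sum_eq_zero fun m _ => H m
  intro m
  have hx' : ∀ i, ∑ k, homogeneousComponent m (G i k) * X k = 0 := by
    intro i
    simp only [← hc_mul_X, ← map_sum, hx, map_zero]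
  rcases m with _ | _ | m
  · have := pd_sum_mul_X j (fun k => homogeneousComponent 0 (G i k))
    rw [hx', map_zero] at this
    simp only [pd_hom0 j _ (homogeneousComponent_isHomogeneous 0 _)] at this
    simpa using this.symm
  · have := Rm_contract (fun i j => homogeneousComponent (0+1) (G i j)) (0+1)
      (fun i j => homogeneousComponent_isHomogeneous _ _) (fun i j => by simp only [hGs i j]) hx' i j
    have z : ∀ a b c d, pderiv a (pderiv b (homogeneousComponent (0+1) (G c d))) = 0 := by
      intro a b c d
      apply pd_hom0
      exact (homogeneousComponent_isHomogeneous (0+1) (G c d)).pderiv (i := b)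
    have z2 : ∀ a b c d, Rm (fun i j => homogeneousComponent (0+1) (G i j)) a b c d = 0 := by
      intro a b c d
      simp only [Rm, z]; ring
    simp only [z2, zero_mul, Finset.sum_const_zero] at this
    rcases mul_eq_zero.1 this.symm with h | h
    · exfalso
      have : (2 : MvPolynomial τ ℝ) = 0 := by
        push_cast at h
        linear_combination h
      exact two_ne_zero this
    · exact h
  · refine radial_hom hc (fun i j => homogeneousComponent (m+2) (G i j))
      (fun i j => homogeneousComponent m (p i j)) m
      (fun i j => homogeneousComponent_isHomogeneous _ _)
      (fun i j => homogeneousComponent_isHomogeneous _ _)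
      (fun i j => by simp only [hGs i j]) (fun i j => by simp only [hps i j]) hx' ?_ ?_ i j
    · rw [← map_sum, ht, map_zero]
    · intro i j k l
      have := congrArg (homogeneousComponent m) (h i j k l)
      simp only [Rm, KN, map_add, map_sub, hc_pderiv, apply_ite (homogeneousComponent m),
        map_zero] at this
      exact this

/-- restriction to the boundary -/
noncomputable def rho {σ : Type*} [DecidableEq σ] (l₀ : σ) :
    MvPolynomial σ ℝ →ₐ[ℝ] MvPolynomial {i : σ // i ≠ l₀} ℝ :=
  aeval fun i => if h : i ≠ l₀ then X ⟨i, h⟩ else 0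

lemma rho_pderiv {σ : Type*} [DecidableEq σ] (l₀ : σ) (a : {i : σ // i ≠ l₀})
    (f : MvPolynomial σ ℝ) : rho l₀ (pderiv a.1 f) = pderiv a (rho l₀ f) := by
  induction f using MvPolynomial.induction_on with
  | C c => simp [rho]
  | add p q hp hq => simp only [map_add, hp, hq]
  | mul_X p i hp =>
    rw [pderiv_mul, map_add, map_mul, map_mul, hp, map_mul, pderiv_mul]
    congr 2
    by_cases h : i = l₀
    · subst h
      rw [pderiv_X_of_ne (Ne.symm a.2)]
      simp [rho]
    · by_cases h2 : i = a.1
      · subst h2; simp [rho, a.2]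
      · rw [pderiv_X_of_ne h2]
        have : (⟨i, h⟩ : {i : σ // i ≠ l₀}) ≠ a := fun e => h2 (by rw [← e])
        simp [rho, h, pderiv_X_of_ne this]

lemma rho_X {σ : Type*} [DecidableEq σ] (l₀ : σ) (a : {i : σ // i ≠ l₀}) :
    rho l₀ (X a.1) = X a := by simp [rho, a.2]

lemma eval_rho {σ : Type*} [DecidableEq σ] (l₀ : σ) (f : MvPolynomial σ ℝ)
    (y : {i : σ // i ≠ l₀} → ℝ) :
    eval y (rho l₀ f) = eval (fun i => if h : i ≠ l₀ then y ⟨i, h⟩ else 0) f := by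
  induction f using MvPolynomial.induction_on with
  | C c => simp [rho]
  | add p q hp hq => simp only [map_add, hp, hq]
  | mul_X p i hp =>
    rw [map_mul, map_mul, hp, map_mul]
    congr 1
    by_cases h : i = l₀ <;> simp [rho, h]

/-- normal Taylor coefficient along the boundary -/
noncomputable def Phi {σ : Type*} [DecidableEq σ] (l₀ : σ) (s : ℕ) :
    MvPolynomial σ ℝ →ₗ[ℝ] MvPolynomial {i : σ // i ≠ l₀} ℝ :=
  (rho l₀).toLinearMap ∘ₗ ((pderiv l₀ : Derivation ℝ (MvPolynomial σ ℝ) _).toLinearMap ^ s)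

lemma Phi_zero {σ : Type*} [DecidableEq σ] (l₀ : σ) (f : MvPolynomial σ ℝ) :
    Phi l₀ 0 f = rho l₀ f := by simp [Phi]

lemma Phi_succ {σ : Type*} [DecidableEq σ] (l₀ : σ) (s : ℕ) (f : MvPolynomial σ ℝ) :
    Phi l₀ (s+1) f = Phi l₀ s (pderiv l₀ f) := by
  simp [Phi, pow_succ]

lemma Phi_pderiv {σ : Type*} [DecidableEq σ] (l₀ : σ) (s : ℕ) (a : {i : σ // i ≠ l₀})
    (f : MvPolynomial σ ℝ) : Phi l₀ s (pderiv a.1 f) = pderiv a (Phi l₀ s f) := by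
  induction s generalizing f with
  | zero => simp only [Phi_zero, rho_pderiv]
  | succ s ih => rw [Phi_succ, Phi_succ, pd_comm, ih]

lemma coeff_iter {σ : Type*} (l₀ : σ) (s : ℕ) (f : MvPolynomial σ ℝ)
    (m : σ →₀ ℕ) (h : coeff (m + Finsupp.single l₀ s) f = 0) :
    coeff m (((pderiv l₀ : Derivation ℝ (MvPolynomial σ ℝ) _).toLinearMap ^ s) f) = 0 := by
  induction s generalizing f with
  | zero => simpa using h
  | succ s ih =>
    rw [pow_succ, Module.End.mul_apply]
    apply ih
    change coeff _ (pderiv l₀ f) = 0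
    rw [coeff_pderiv]
    rw [add_assoc, ← Finsupp.single_add, h, zero_mul]

lemma eq_zero_of_const {σ : Type*} [DecidableEq σ] (l₀ : σ) (f : MvPolynomial σ ℝ)
    (h1 : pderiv l₀ f = 0) (h2 : rho l₀ f = 0) : f = 0 := by
  have hv : (f.vars : Set σ) ⊆ Set.range (Subtype.val : {i : σ // i ≠ l₀} → σ) := by
    intro i hi
    rw [Subtype.range_coe_subtype]
    rintro rfl
    obtain ⟨d, hd, hd2⟩ := (mem_vars_iff_mem_support i).1 hi
    have e := congrArg (coeff (d - Finsupp.single i 1)) h1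
    rw [coeff_pderiv, coeff_zero] at e
    have : d - Finsupp.single i 1 + Finsupp.single i 1 = d := by
      ext j; by_cases hj : i = j
      · subst hj; simp at hd2 ⊢; omega
      · simp [Finsupp.single_apply, hj]
    rw [this] at e
    rcases mul_eq_zero.1 e with e | e
    · exact (mem_support_iff.1 hd) e
    · have : (0:ℝ) < (((d - Finsupp.single i 1 : σ →₀ ℕ) i : ℕ) : ℝ) + 1 := by positivity
      linarith
  obtain ⟨g, rfl⟩ := exists_rename_eq_of_vars_subset_range f _ Subtype.val_injective hv
  have : rho l₀ (rename Subtype.val g) = g := by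
    rw [rho, aeval_rename]
    have : ((fun i => if h : i ≠ l₀ then X ⟨i, h⟩ else 0) ∘ Subtype.val :
      {i : σ // i ≠ l₀} → MvPolynomial {i : σ // i ≠ l₀} ℝ) = X := by
      funext a; simp [a.2]
    rw [this]; simp
  rw [this] at h2
  simp [h2]

lemma eq_zero_of_Phi {σ : Type*} [DecidableEq σ] (l₀ : σ) (f : MvPolynomial σ ℝ)
    (h : ∀ s, Phi l₀ s f = 0) : f = 0 := by
  have key : ∀ t, ∀ f : MvPolynomial σ ℝ, (∀ s, Phi l₀ s f = 0) →
      (((pderiv l₀ : Derivation ℝ (MvPolynomial σ ℝ) _).toLinearMap ^ t) f) = 0 → f = 0 := by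
    intro t
    induction t with
    | zero => intro f _ h; simpa using h
    | succ t ih =>
      intro f h1 h2
      apply eq_zero_of_const l₀
      · apply ih
        · intro s; rw [← Phi_succ]; exact h1 _
        · rw [pow_succ] at h2; exact h2
      · rw [← Phi_zero]; exact h1 0
  refine key (f.totalDegree + 1) f h ?_
  ext m
  rw [coeff_zero]
  apply coeff_iter
  apply coeff_eq_zero_of_totalDegree_lt
  have : f.totalDegree + 1 ≤ (m + Finsupp.single l₀ (f.totalDegree + 1)).degree := by
    simp [map_add]
  rw [Finsupp.degree_apply] at this
  exact this

lemma KN_zero {τ : Type*} [Fintype τ] [DecidableEq τ] (hc : 4 ≤ Fintype.card τ)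
    (p : τ → τ → MvPolynomial τ ℝ) (h : ∀ i j k l, KN p i j k l = 0) (a b : τ) : p a b = 0 := by
  have D2 : ∀ i j, i ≠ j → p j j + p i i = 0 := by
    intro i j hij
    have := h i j i j
    simpa [KN, hij, hij.symm] using this
  by_cases hab : a = b
  · subst hab
    obtain ⟨i, i1, _, _⟩ := exists_ne3 hc a a a
    obtain ⟨k, k1, k2, _⟩ := exists_ne3 hc a i i
    have : (2 : MvPolynomial τ ℝ) * p a a = 0 := by
      linear_combination D2 i a i1 + D2 k a k1 - D2 k i k2
    exact (mul_eq_zero.1 this).resolve_left two_ne_zero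
  · obtain ⟨i, i1, i2, _⟩ := exists_ne3 hc a b b
    have := h i a i b
    simpa [KN, hab, i1, i2, Ne.symm i1] using this

theorem full {σ : Type*} [Fintype σ] [DecidableEq σ] (hc : 5 ≤ Fintype.card σ) (l₀ : σ)
    (H p : σ → σ → MvPolynomial σ ℝ)
    (hHs : ∀ i j, H i j = H j i) (hps : ∀ i j, p i j = p j i)
    (hn : ∀ i, H i l₀ = 0) (ht : ∑ i, H i i = 0)
    (hx : ∀ i, rho l₀ (∑ k, H i k * X k) = 0) (hd : ∀ i k, rho l₀ (pderiv l₀ (H i k)) = 0)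
    (h : ∀ i j k l, Rm H i j k l = KN p i j k l) (i j : σ) : H i j = 0 := by
  have hc' : 4 ≤ Fintype.card {i : σ // i ≠ l₀} := by
    rw [Fintype.card_subtype_compl, Fintype.card_subtype_eq]; omega
  have hn' : ∀ i, H l₀ i = 0 := fun i => by rw [hHs, hn]
  have PRm : ∀ s (a b c d : {i : σ // i ≠ l₀}), Phi l₀ s (Rm H a.1 b.1 c.1 d.1) =
      Rm (fun a b : {i : σ // i ≠ l₀} => Phi l₀ s (H a.1 b.1)) a b c d := by
    intro s a b c d
    simp only [Rm, map_add, map_sub, Phi_pderiv]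
  have PKN : ∀ s (a b c d : {i : σ // i ≠ l₀}), Phi l₀ s (KN p a.1 b.1 c.1 d.1) =
      KN (fun a b : {i : σ // i ≠ l₀} => Phi l₀ s (p a.1 b.1)) a b c d := by
    intro s a b c d
    simp only [KN, map_add, map_sub, apply_ite (Phi l₀ s), map_zero, Subtype.ext_iff]
  have Pt : ∀ s, ∑ a : {i : σ // i ≠ l₀}, Phi l₀ s (H a.1 a.1) = 0 := by
    intro s
    have := congrArg (Phi l₀ s) ht
    rw [Fintype.sum_eq_add_sum_subtype_ne _ l₀, hn, zero_add, map_zero, map_sum] at this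
    exact this
  suffices S : ∀ s, ∀ a b : {i : σ // i ≠ l₀}, Phi l₀ s (H a.1 b.1) = 0 by
    by_cases h1 : i = l₀
    · rw [h1, hn']
    by_cases h2 : j = l₀
    · rw [h2, hn]
    exact eq_zero_of_Phi l₀ _ fun s => S s ⟨i, h1⟩ ⟨j, h2⟩
  intro s
  induction s using Nat.strong_induction_on with
  | _ s ih =>
  rcases s with _ | _ | s
  · refine radial hc' (fun a b => Phi l₀ 0 (H a.1 b.1)) (fun a b => Phi l₀ 0 (p a.1 b.1))
      (fun a b => by simp only [hHs a.1 b.1]) (fun a b => by simp only [hps a.1 b.1]) ?_ (Pt 0) ?_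
    · intro a
      have := hx a.1
      rw [Fintype.sum_eq_add_sum_subtype_ne _ l₀, hn, zero_mul, zero_add, map_sum] at this
      simpa only [Phi_zero, map_mul, rho_X] using this
    · intro a b c d
      rw [← PRm, h, PKN]
  · intro a b
    rw [Phi_succ, Phi_zero, hd]
  · have p0 : ∀ a b : {i : σ // i ≠ l₀}, Phi l₀ s (p a.1 b.1) = 0 := by
      refine KN_zero hc' (fun a b => Phi l₀ s (p a.1 b.1)) ?_
      intro a b c d
      rw [← PKN, ← h, PRm]
      simp only [Rm, ih s (by omega), map_zero]; ring
    have e : ∀ a c : {i : σ // i ≠ l₀}, Phi l₀ (s+2) (H a.1 c.1) =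
        if a = c then Phi l₀ s (p l₀ l₀) else 0 := by
      intro a c
      rw [Phi_succ, Phi_succ]
      have := h a.1 l₀ c.1 l₀
      simp only [Rm, KN, hn, hn', map_zero, a.2, Ne.symm c.2, if_false, if_true] at this
      have e2 : pderiv l₀ (pderiv l₀ (H a.1 c.1)) =
        (if a.1 = c.1 then p l₀ l₀ else 0) + p a.1 c.1 := by linear_combination this
      rw [e2, map_add, p0, add_zero, apply_ite (Phi l₀ s), map_zero]
      simp only [Subtype.ext_iff]
    have z : Phi l₀ s (p l₀ l₀) = 0 := by
      have := Pt (s+2)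
      simp only [e, if_true, Finset.sum_const, Finset.card_univ, nsmul_eq_mul] at this
      rcases mul_eq_zero.1 this with h | h
      · have : Fintype.card {i : σ // i ≠ l₀} = 0 := by exact_mod_cast h
        omega
      · exact h
    intro a b
    rw [e, z, ite_self]

/-- polynomial version of `Aop` -/
def AP {n : ℕ} (P : Fin n → Fin n → MvPolynomial (Fin n) ℝ) (i k : Fin n) :
    MvPolynomial (Fin n) ℝ :=
  (∑ m, pderiv i (pderiv m (P m k))) + (∑ m, pderiv m (pderiv k (P i m)))
    - (∑ m, pderiv m (pderiv m (P i k)))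
    - C (1 / ((n : ℝ) - 1)) * (∑ m, ∑ p, pderiv m (pderiv p (P m p))) * C (kd i k)

/-- polynomial version of `Zop` -/
def ZP {n : ℕ} (P : Fin n → Fin n → MvPolynomial (Fin n) ℝ) (i j k l : Fin n) :
    MvPolynomial (Fin n) ℝ :=
  pderiv i (pderiv k (P j l)) - pderiv i (pderiv l (P j k)) - pderiv j (pderiv k (P i l))
      + pderiv j (pderiv l (P i k))
      + C (1 / ((n : ℝ) - 2)) * (AP P j l * C (kd i k) - AP P j k * C (kd i l)
          - AP P i l * C (kd j k) + AP P i k * C (kd j l))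

lemma pd_eval_aux {n : ℕ} (i : Fin n) (f : MvPolynomial (Fin n) ℝ) (x : Euc n) :
    DifferentiableAt ℝ (fun x : Euc n => eval (fun m => x m) f) x ∧
    pd i (fun x : Euc n => eval (fun m => x m) f) x = eval (fun m => x m) (pderiv i f) := by
  induction f using MvPolynomial.induction_on with
  | C c => simp [pd]
  | add p q hp hq =>
    obtain ⟨hp1, hp2⟩ := hp
    obtain ⟨hq1, hq2⟩ := hq
    simp only [map_add]
    refine ⟨hp1.add hq1, ?_⟩
    rw [← hp2, ← hq2]
    simp only [pd]
    rw [fderiv_fun_add hp1 hq1]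
    rfl
  | mul_X p j hp =>
    obtain ⟨hp1, hp2⟩ := hp
    have hj : HasFDerivAt (fun x : Euc n => x j) (EuclideanSpace.proj j : Euc n →L[ℝ] ℝ) x :=
      (EuclideanSpace.proj j : Euc n →L[ℝ] ℝ).hasFDerivAt
    simp only [map_mul, eval_X, pderiv_mul, map_add]
    refine ⟨hp1.mul hj.differentiableAt, ?_⟩
    rw [← hp2]
    simp only [pd]
    rw [fderiv_fun_mul hp1 hj.differentiableAt, hj.fderiv]
    change eval (fun m => x m) p * (EuclideanSpace.single i (1:ℝ) : Euc n) j
      + x j * (fderiv ℝ (fun x : Euc n => eval (fun m => x m) p) x) (EuclideanSpace.single i 1) = _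
    rw [pderiv_X]
    by_cases h : i = j
    · subst h; simp; ring
    · simp [h, Ne.symm h]; ring

lemma pd_eval {n : ℕ} (i : Fin n) (f : MvPolynomial (Fin n) ℝ) :
    pd i (fun x : Euc n => eval (fun m => x m) f) =
      fun x : Euc n => eval (fun m => x m) (pderiv i f) := by
  funext x; exact (pd_eval_aux i f x).2

lemma Zop_eval {n : ℕ} (H : Fin n → Fin n → Euc n → ℝ)
    (P : Fin n → Fin n → MvPolynomial (Fin n) ℝ)
    (h : ∀ i k, H i k = fun x : Euc n => eval (fun m => x m) (P i k)) (i j k l : Fin n) (x : Euc n) :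
    Zop H i j k l x = eval (fun m => x m) (ZP P i j k l) := by
  simp only [Zop, Aop, ZP, AP, h, pd_eval, map_add, map_sub, map_mul, map_sum, eval_C]

/-- admissible polynomial tensors -/
structure Good {n : ℕ} (l₀ : Fin n) (P : Fin n → Fin n → MvPolynomial (Fin n) ℝ) : Prop where
  sym : ∀ i k, P i k = P k i
  tr : ∑ i, P i i = 0
  nor : ∀ i, P i l₀ = 0
  rad : ∀ x : Fin n → ℝ, x l₀ = 0 → ∀ i, ∑ k, eval x (P i k) * x k = 0
  der : ∀ x : Fin n → ℝ, x l₀ = 0 → ∀ i k, eval x (pderiv l₀ (P i k)) = 0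

lemma rho_zero_of {n : ℕ} (l₀ : Fin n) (f : MvPolynomial (Fin n) ℝ)
    (h : ∀ x : Fin n → ℝ, x l₀ = 0 → eval x f = 0) : rho l₀ f = 0 := by
  apply MvPolynomial.funext
  intro y
  rw [eval_rho, h _ (by simp), map_zero]

lemma AP_symm {n : ℕ} (P : Fin n → Fin n → MvPolynomial (Fin n) ℝ) (hs : ∀ i k, P i k = P k i)
    (i k : Fin n) : AP P i k = AP P k i := by
  have e1 : ∀ i k, ∑ m, pderiv m (pderiv k (P i m)) = ∑ m, pderiv k (pderiv m (P m i)) := by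
    intro i k
    refine Finset.sum_congr rfl fun m _ => ?_
    rw [pd_comm, hs i m]
  have e2 : kd i k = kd k i := by simp [kd, eq_comm]
  simp only [AP]
  rw [e1 i k, e1 k i, e2]
  simp only [hs i k]
  ring

lemma inj {n : ℕ} (hn : 5 ≤ n) (l₀ : Fin n) (P : Fin n → Fin n → MvPolynomial (Fin n) ℝ)
    (hP : Good l₀ P) (hZ : ∀ i j k l, ZP P i j k l = 0) (i k : Fin n) : P i k = 0 := by
  refine full (by simpa using hn) l₀ P (fun j l => - (C (1 / ((n : ℝ) - 2)) * AP P j l))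
    hP.sym (fun i j => by rw [AP_symm P hP.sym]) hP.nor hP.tr ?_ ?_ ?_ i k
  · intro i
    apply rho_zero_of
    intro x hx
    simpa using hP.rad x hx i
  · intro i k
    apply rho_zero_of
    intro x hx
    exact hP.der x hx i k
  · intro i j k l
    have := hZ i j k l
    have hk : ∀ (a b : Fin n) (f : MvPolynomial (Fin n) ℝ),
        (if a = b then - (C (1 / ((n : ℝ) - 2)) * f) else 0) =
        - (C (1 / ((n : ℝ) - 2)) * (f * C (kd a b))) := by
      intro a b f
      simp only [kd]; split_ifs <;> simp
    simp only [Rm, KN, hk]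
    simp only [ZP] at this
    linear_combination this

lemma AP_add {n : ℕ} (P Q : Fin n → Fin n → MvPolynomial (Fin n) ℝ) (i k : Fin n) :
    AP (fun i k => P i k + Q i k) i k = AP P i k + AP Q i k := by
  simp only [AP, map_add, Finset.sum_add_distrib]; ring

lemma AP_smul {n : ℕ} (c : ℝ) (P : Fin n → Fin n → MvPolynomial (Fin n) ℝ) (i k : Fin n) :
    AP (fun i k => C c * P i k) i k = C c * AP P i k := by
  simp only [AP, pderiv_C_mul, ← Finset.mul_sum]; ring

lemma ZP_smul {n : ℕ} (c : ℝ) (P : Fin n → Fin n → MvPolynomial (Fin n) ℝ) (i j k l : Fin n) :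
    ZP (fun i k => C c * P i k) i j k l = C c * ZP P i j k l := by
  simp only [ZP, AP_smul, pderiv_C_mul]; ring

/-- dilation -/
def dil {n : ℕ} (r : ℝ) : MvPolynomial (Fin n) ℝ →ₐ[ℝ] MvPolynomial (Fin n) ℝ :=
  aeval fun i => C r * X i

lemma dil_C {n : ℕ} (r c : ℝ) : dil (n := n) r (C c) = C c := by simp [dil]

lemma pderiv_dil {n : ℕ} (r : ℝ) (i : Fin n) (f : MvPolynomial (Fin n) ℝ) :
    pderiv i (dil r f) = C r * dil r (pderiv i f) := by
  induction f using MvPolynomial.induction_on with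
  | C c => simp [dil]
  | add p q hp hq => simp only [map_add, hp, hq, mul_add]
  | mul_X p j hp =>
    have : pderiv i (dil r (X j)) = C r * dil r (pderiv i (X j)) := by
      by_cases h : j = i
      · subst h; simp [dil]
      · simp [dil, pderiv_X_of_ne h]
    rw [map_mul, pderiv_mul, pderiv_mul, hp, this, map_add, map_mul, map_mul]; ring

lemma eval_dil {n : ℕ} (r : ℝ) (f : MvPolynomial (Fin n) ℝ) (x : Fin n → ℝ) :
    eval x (dil r f) = eval (fun m => r * x m) f := by
  induction f using MvPolynomial.induction_on with
  | C c => simp [dil]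
  | add p q hp hq => simp only [map_add, hp, hq]
  | mul_X p j hp => rw [map_mul, map_mul, hp, map_mul]; simp [dil]

lemma AP_dil {n : ℕ} (r : ℝ) (P : Fin n → Fin n → MvPolynomial (Fin n) ℝ) (i k : Fin n) :
    AP (fun i k => dil r (P i k)) i k = C r * C r * dil r (AP P i k) := by
  simp only [AP, pderiv_dil, pderiv_C_mul, ← mul_assoc, ← Finset.mul_sum, map_add, map_sub,
    map_mul, map_sum, dil_C]
  ring

lemma ZP_dil {n : ℕ} (r : ℝ) (P : Fin n → Fin n → MvPolynomial (Fin n) ℝ) (i j k l : Fin n) :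
    ZP (fun i k => dil r (P i k)) i j k l = C r * C r * dil r (ZP P i j k l) := by
  simp only [ZP, AP_dil, pderiv_dil, pderiv_C_mul, ← mul_assoc, map_add, map_sub,
    map_mul, dil_C]
  ring

lemma Good.dil {n : ℕ} {l₀ : Fin n} {P : Fin n → Fin n → MvPolynomial (Fin n) ℝ}
    (hP : Good l₀ P) (r : ℝ) (hr : r ≠ 0) : Good l₀ (fun i k => dil r (P i k)) where
  sym i k := by rw [hP.sym]
  tr := by rw [← map_sum, hP.tr, map_zero]
  nor i := by rw [hP.nor, map_zero]
  rad x hx i := by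
    have := hP.rad (fun m => r * x m) (by simp [hx]) i
    simp only [eval_dil]
    have e : ∑ k, eval (fun m => r * x m) (P i k) * (r * x k) =
       r * ∑ k, eval (fun m => r * x m) (P i k) * x k := by
      rw [Finset.mul_sum]; exact Finset.sum_congr rfl fun _ _ => by ring
    rw [e] at this
    exact (mul_eq_zero.1 this).resolve_left hr
  der x hx i k := by
    rw [pderiv_dil, map_mul, eval_dil, hP.der _ (by simp [hx]), mul_zero]

/-- index type of coefficients -/
abbrev Idx (n d : ℕ) := Fin n × Fin n × {α : Fin n → ℕ // α ∈ MIdx n d}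

/-- tensor with given coefficients -/
def toP {n d : ℕ} (v : Idx n d → ℝ) (i k : Fin n) : MvPolynomial (Fin n) ℝ :=
  ∑ α : {α : Fin n → ℕ // α ∈ MIdx n d}, C (v (i, k, α)) * ∏ m, X m ^ α.1 m

lemma toP_add {n d : ℕ} (v w : Idx n d → ℝ) (i k : Fin n) :
    toP (v + w) i k = toP v i k + toP w i k := by
  simp [toP, add_mul, Finset.sum_add_distrib]

lemma toP_smul {n d : ℕ} (c : ℝ) (v : Idx n d → ℝ) (i k : Fin n) :
    toP (c • v) i k = C c * toP v i k := by
  simp [toP, mul_assoc, Finset.mul_sum]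

lemma toP_eq_zero {n d : ℕ} (v : Idx n d → ℝ) (h : ∀ i k, toP v i k = 0) : v = 0 := by
  funext ⟨i, k, α⟩
  have := congrArg (coeff (Finsupp.equivFunOnFinite.symm α.1)) (h i k)
  have e : ∀ β : Fin n → ℕ, (∏ m, X m ^ β m : MvPolynomial (Fin n) ℝ) =
      monomial (Finsupp.equivFunOnFinite.symm β) 1 := by
    intro β
    rw [monomial_eq, C_1, one_mul, Finsupp.prod_fintype _ _ (by simp)]
    rfl
  simp only [toP, e, coeff_sum, coeff_C_mul, coeff_monomial, coeff_zero, mul_ite, mul_one,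
    mul_zero, EmbeddingLike.apply_eq_iff_eq] at this
  rw [Finset.sum_eq_single α] at this
  · simpa using this
  · intro b _ hb
    rw [if_neg]
    exact fun e => hb (Subtype.ext e)
  · simp

/-- admissible coefficient space -/
def Wsub {n : ℕ} (d : ℕ) (l₀ : Fin n) : Submodule ℝ (Idx n d → ℝ) where
  carrier := {v | Good l₀ (toP v)}
  add_mem' := by
    intro v w hv hw
    refine ⟨?_, ?_, ?_, ?_, ?_⟩
    · intro i k; rw [toP_add, toP_add, hv.sym, hw.sym]
    · simp only [toP_add, Finset.sum_add_distrib, hv.tr, hw.tr, add_zero]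
    · intro i; rw [toP_add, hv.nor, hw.nor, add_zero]
    · intro x hx i
      simp only [toP_add, map_add, add_mul, Finset.sum_add_distrib, hv.rad x hx, hw.rad x hx,
        add_zero]
    · intro x hx i k
      simp only [toP_add, map_add, hv.der x hx, hw.der x hx, add_zero]
  zero_mem' := by
    have : ∀ i k, toP (0 : Idx n d → ℝ) i k = 0 := by intro i k; simp [toP]
    refine ⟨?_, ?_, ?_, ?_, ?_⟩ <;> simp [this]
  smul_mem' := by
    intro c v hv
    refine ⟨?_, ?_, ?_, ?_, ?_⟩
    · intro i k; rw [toP_smul, toP_smul, hv.sym]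
    · simp only [toP_smul, ← Finset.mul_sum, hv.tr, mul_zero]
    · intro i; rw [toP_smul, hv.nor, mul_zero]
    · intro x hx i
      simp only [toP_smul, map_mul, mul_assoc, ← Finset.mul_sum, hv.rad x hx, mul_zero]
    · intro x hx i k
      simp only [toP_smul, pderiv_C_mul, map_mul, hv.der x hx, mul_zero]

lemma compact_ineq {V : Type*} [NormedAddCommGroup V] [NormedSpace ℝ V] [FiniteDimensional ℝ V]
    (W : Submodule ℝ V) (Q1 Q2 : V → ℝ) (c1 : Continuous Q1) (c2 : Continuous Q2)
    (h1 : ∀ (c : ℝ) v, Q1 (c • v) = c ^ 2 * Q1 v) (h2 : ∀ (c : ℝ) v, Q2 (c • v) = c ^ 2 * Q2 v)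
    (hpos : ∀ v ∈ W, v ≠ 0 → 0 < Q2 v) :
    ∃ K : ℝ, 0 < K ∧ ∀ v ∈ W, Q1 v ≤ K * Q2 v := by
  have hK : IsCompact (Metric.sphere (0:V) 1 ∩ (W : Set V)) := by
    have := FiniteDimensional.proper ℝ V
    exact (isCompact_sphere _ _).inter_right W.closed_of_finiteDimensional
  have hne : ∀ v ∈ Metric.sphere (0:V) 1 ∩ (W : Set V), 0 < Q2 v := by
    rintro v ⟨hv, hw⟩
    apply hpos v hw
    rintro rfl
    simp at hv
  obtain ⟨M, hM⟩ := hK.bddAbove_image (f := fun v => Q1 v / Q2 v)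
    (c1.continuousOn.div c2.continuousOn fun v hv => (hne v hv).ne')
  refine ⟨max M 1, by positivity, ?_⟩
  intro v hv
  by_cases h0 : v = 0
  · subst h0
    have a := h1 0 0
    have b := h2 0 0
    simp at a b
    rw [a, b]; simp
  · have hv0 : 0 < ‖v‖ := norm_pos_iff.2 h0
    set u := ‖v‖⁻¹ • v with hu
    have hus : u ∈ Metric.sphere (0:V) 1 ∩ (W : Set V) := by
      refine ⟨?_, W.smul_mem _ hv⟩
      simp [hu, norm_smul, hv0.ne']
    have e : v = ‖v‖ • u := by rw [hu, smul_smul, mul_inv_cancel₀ hv0.ne', one_smul]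
    have q2 := hne u hus
    have l1 : Q1 u / Q2 u ≤ M := hM ⟨u, hus, rfl⟩
    have l2 : Q1 u ≤ max M 1 * Q2 u := by
      rw [div_le_iff₀ q2] at l1
      exact l1.trans (mul_le_mul_of_nonneg_right (le_max_left _ _) q2.le)
    rw [e, h1, h2]
    nlinarith [mul_le_mul_of_nonneg_left l2 (sq_nonneg ‖v‖)]

lemma cont_aux {n d : ℕ} (D : MvPolynomial (Fin n) ℝ →ₗ[ℝ] MvPolynomial (Fin n) ℝ) (i k : Fin n) :
    Continuous fun z : (Idx n d → ℝ) × Euc n => eval (fun m => z.2 m) (D (toP z.1 i k)) := by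
  simp only [toP, map_sum, C_mul', map_smul, smul_eval]
  refine continuous_finsetSum _ fun α _ => ?_
  refine Continuous.mul (by fun_prop) ?_
  exact (MvPolynomial.continuous_eval _).comp (by fun_prop)

lemma cont_aux2 {n d : ℕ} (a b i k : Fin n) :
    Continuous fun z : (Idx n d → ℝ) × Euc n =>
      eval (fun m => z.2 m) (pderiv a (pderiv b (toP z.1 i k))) :=
  cont_aux ((pderiv a).toLinearMap ∘ₗ (pderiv b).toLinearMap) i k

lemma cont_Z {n d : ℕ} (i j k l : Fin n) :
    Continuous fun z : (Idx n d → ℝ) × Euc n => eval (fun m => z.2 m) (ZP (toP z.1) i j k l) := by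
  have h := fun a b i k => cont_aux2 (n := n) (d := d) a b i k
  simp only [ZP, AP, map_add, map_sub, map_mul, map_sum, eval_C]
  fun_prop

/-- integrand -/
def dens {n d : ℕ} (v : Idx n d → ℝ) (x : Euc n) : ℝ :=
  ∑ i, ∑ j, ∑ k, ∑ l, (eval (fun m => x m) (ZP (toP v) i j k l)) ^ 2

lemma cont_dens {n d : ℕ} : Continuous (Function.uncurry (dens (n := n) (d := d))) := by
  have h := fun i j k l => cont_Z (n := n) (d := d) i j k l
  simp only [Function.uncurry_def, dens]
  fun_prop

lemma cont_dens1 {n d : ℕ} (v : Idx n d → ℝ) : Continuous (dens v) := by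
  have h : Continuous (fun x : Euc n => (v, x)) := by fun_prop
  have h2 := (cont_dens (n := n) (d := d)).comp h
  exact h2

lemma ball_ae {n : ℕ} (c : Euc n) :
    (Metric.ball c (1/4) : Set (Euc n)) =ᵐ[volume] Metric.closedBall c (1/4) := by
  rw [ae_eq_set]
  refine ⟨?_, ?_⟩
  · rw [Set.diff_eq_empty.2 Metric.ball_subset_closedBall, measure_empty]
  · rw [Metric.closedBall_sdiff_ball]
    exact Measure.addHaar_sphere_of_ne_zero volume c (by norm_num)

lemma dens_nonneg {n d : ℕ} (v : Idx n d → ℝ) (x : Euc n) : 0 ≤ dens v x := by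
  unfold dens; positivity

lemma poly_zero_of_open {n : ℕ} (f : MvPolynomial (Fin n) ℝ) (U : Set (Euc n)) (hU : IsOpen U)
    (hne : U.Nonempty) (h : ∀ x ∈ U, eval (fun m => x m) f = 0) : f = 0 := by
  obtain ⟨c, hcU⟩ := hne
  have ho : IsOpen ((fun y : Fin n → ℝ => (WithLp.toLp 2 y : Euc n)) ⁻¹' U) :=
    hU.preimage (PiLp.continuous_toLp 2 _)
  obtain ⟨ε, hε, hb⟩ := Metric.isOpen_iff.1 ho (fun m => c m) hcU
  refine MvPolynomial.funext_set (fun i => Metric.ball (c i) ε) ?_ ?_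
  · intro i
    rw [Real.ball_eq_Ioo]
    exact Set.Ioo_infinite (by linarith)
  · intro x hx
    rw [map_zero]
    refine h (WithLp.toLp 2 x) (hb ?_)
    rw [ball_pi _ hε]
    exact hx

lemma base_ineq (n d : ℕ) (hn : 5 ≤ n) (l₀ : Fin n) (c : Euc n) :
    ∃ K : ℝ, 0 < K ∧ ∀ v : Idx n d → ℝ, Good l₀ (toP v) →
      (∑ α, ∑ i, ∑ k, v (i, k, α) ^ 2) ≤ K * ∫ x in Metric.ball c (1/4), dens v x := by
  refine compact_ineq (Wsub d l₀) (fun v : Idx n d → ℝ => ∑ α, ∑ i, ∑ k, v (i, k, α) ^ 2)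
    (fun v => ∫ x in Metric.ball c (1/4), dens v x) (by fun_prop) ?_ ?_ ?_ ?_
  · have e : ∀ v : Idx n d → ℝ, ∫ x in Metric.ball c (1/4), dens v x =
        ∫ x in Metric.closedBall c (1/4), dens v x := by
      intro v
      apply setIntegral_congr_set
      exact ball_ae c
    simp only [e]
    exact continuous_parametric_integral_of_continuous cont_dens (isCompact_closedBall c (1/4))
  · intro a v
    simp [mul_pow, Finset.mul_sum]
  · intro a v
    rw [← integral_const_mul]
    congr 1
    funext x
    have : toP (a • v) = fun i k => C a * toP v i k := by funext i k; exact toP_smul a v i k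
    simp only [dens, this, ZP_smul, map_mul, eval_C, mul_pow, Finset.mul_sum]
  · intro v hv hv0
    have hcd : Continuous (dens v) := cont_dens1 v
    have hex : ∃ x ∈ Metric.ball c (1/4), dens v x ≠ 0 := by
      by_contra hcon
      push Not at hcon
      apply hv0
      apply toP_eq_zero
      refine inj hn l₀ _ hv ?_
      intro i j k l
      refine poly_zero_of_open _ (Metric.ball c (1/4)) Metric.isOpen_ball ⟨c, by simp⟩ ?_
      intro x hx
      have h0 := hcon x hx
      unfold dens at h0
      rw [Finset.sum_eq_zero_iff_of_nonneg (fun _ _ => by positivity)] at h0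
      have h1 := h0 i (Finset.mem_univ _)
      rw [Finset.sum_eq_zero_iff_of_nonneg (fun _ _ => by positivity)] at h1
      have h2 := h1 j (Finset.mem_univ _)
      rw [Finset.sum_eq_zero_iff_of_nonneg (fun _ _ => by positivity)] at h2
      have h3 := h2 k (Finset.mem_univ _)
      rw [Finset.sum_eq_zero_iff_of_nonneg (fun _ _ => by positivity)] at h3
      exact pow_eq_zero_iff (two_ne_zero) |>.1 (h3 l (Finset.mem_univ _))
    have hint : IntegrableOn (dens v) (Metric.ball c (1/4)) :=
      (hcd.continuousOn.integrableOn_compact (isCompact_closedBall c (1/4))).mono_set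
        Metric.ball_subset_closedBall
    rw [setIntegral_pos_iff_support_of_nonneg_ae (Filter.Eventually.of_forall (dens_nonneg v)) hint]
    obtain ⟨x, hx, hx0⟩ := hex
    refine IsOpen.measure_pos _ ?_ ⟨x, hx0, hx⟩
    exact (hcd.isOpen_support).inter Metric.isOpen_ball

lemma dil_toP {n d : ℕ} (r : ℝ) (v : Idx n d → ℝ) (i k : Fin n) :
    toP (fun z : Idx n d => v z * r ^ (∑ m, z.2.2.1 m)) i k = dil r (toP v i k) := by
  simp only [toP, map_sum, map_mul, dil_C, map_prod, map_pow]
  refine Finset.sum_congr rfl fun α _ => ?_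
  have : ∀ m, dil (n := n) r (X m) = C r * X m := by intro m; simp [dil]
  simp only [this, mul_pow, Finset.prod_mul_distrib, Finset.prod_pow_eq_pow_sum]
  ring

end S4

/-- There is a constant `K₁ > 0`, depending only on `n`, such that
`Σ_{2≤|α|≤d} Σ_{i,k} |h_{ik,α}|² r^{2|α|-4+n} ≤ K₁ ∫_{U_r} Σ |Z_{ijkl}|²` for all `r > 0`,
where `U_r` is the ball of radius `r/4` centered at `(0,…,0,3r/2)`. -/
theorem statement4 (n : ℕ) (hn : 6 ≤ n) (l₀ : Fin n) (hl₀ : (l₀ : ℕ) = n - 1)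
    (d : ℕ) (hd : d = (n - 2) / 2) :
    ∃ K₁ : ℝ, 0 < K₁ ∧
      ∀ (h : Fin n → Fin n → (Fin n → ℕ) → ℝ) (H : Fin n → Fin n → Euc n → ℝ),
        (∀ i k x, H i k x = ∑ α ∈ MIdx n d, h i k α * ∏ m, x m ^ α m) →
        (∀ i k x, H i k x = H k i x) →
        (∀ x, ∑ i, H i i x = 0) →
        (∀ x : Euc n, 0 ≤ x l₀ → ∀ i, H i l₀ x = 0) →
        (∀ x : Euc n, x l₀ = 0 → ∀ i, ∑ k, H i k x * x k = 0) →
        (∀ x : Euc n, x l₀ = 0 → ∀ i k, pd l₀ (H i k) x = 0) →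
        ∀ r : ℝ, 0 < r →
          ∑ α ∈ MIdx n d, ∑ i, ∑ k,
              (h i k α) ^ 2 * r ^ (2 * (∑ m, (α m : ℝ)) - 4 + (n : ℝ))
            ≤ K₁ * ∫ x in Metric.ball (EuclideanSpace.single l₀ (3 * r / 2)) (r / 4),
                ∑ i, ∑ j, ∑ k, ∑ l, (Zop H i j k l x) ^ 2 := by
  obtain ⟨K, hK, hmain⟩ := S4.base_ineq n d (by omega) l₀ (EuclideanSpace.single l₀ (3 / 2))
  refine ⟨K, hK, ?_⟩
  intro h H hH hsym htr hnor hrad hder r hr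
  set v : S4.Idx n d → ℝ := fun z => h z.1 z.2.1 z.2.2.1 with hv
  have hHP : ∀ i k, H i k = fun x : Euc n => MvPolynomial.eval (fun m => x m) (S4.toP v i k) := by
    intro i k
    funext x
    rw [hH, ← Finset.sum_coe_sort]
    simp [S4.toP, hv]
  have hHP' : ∀ i k (y : Fin n → ℝ), H i k (WithLp.toLp 2 y) =
      MvPolynomial.eval y (S4.toP v i k) := by
    intro i k y; rw [hHP]
  have good : S4.Good l₀ (S4.toP v) := by
    refine ⟨?_, ?_, ?_, ?_, ?_⟩
    · intro i k
      apply MvPolynomial.funext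
      intro y
      rw [← hHP', ← hHP', hsym]
    · apply MvPolynomial.funext
      intro y
      simp only [map_sum, ← hHP', htr, map_zero]
    · intro i
      refine MvPolynomial.funext_set (fun _ => Set.Ioi 0) (fun _ => Set.Ioi_infinite _) ?_
      intro y hy
      rw [← hHP', map_zero]
      exact hnor _ (le_of_lt (hy l₀ (Set.mem_univ _))) i
    · intro y hy i
      simp only [← hHP']
      exact hrad (WithLp.toLp 2 y) hy i
    · intro y hy i k
      have := hder (WithLp.toLp 2 y) hy i k
      rw [hHP, S4.pd_eval] at this
      exact this
  set w : S4.Idx n d → ℝ := fun z => v z * r ^ (∑ m, z.2.2.1 m) with hw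
  have hwP : S4.toP w = fun i k => S4.dil r (S4.toP v i k) := by
    funext i k; exact S4.dil_toP r v i k
  have main := hmain w (by rw [hwP]; exact good.dil r hr.ne')
  have hd1 : ∀ x : Euc n, S4.dens w x = r ^ 4 * S4.dens v (r • x) := by
    intro x
    simp only [S4.dens, hwP, S4.ZP_dil, map_mul, MvPolynomial.eval_C, S4.eval_dil, Finset.mul_sum]
    refine Finset.sum_congr rfl fun i _ => Finset.sum_congr rfl fun j _ =>
      Finset.sum_congr rfl fun k _ => Finset.sum_congr rfl fun l _ => ?_
    have : (fun m => r * x m) = fun m => (r • x) m := by funext m; simp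
    rw [this]; ring
  have hI : ∫ x in Metric.ball (EuclideanSpace.single l₀ (3 / 2) : Euc n) (1/4), S4.dens w x =
      r ^ 4 * ((r ^ n)⁻¹ * ∫ x in Metric.ball (EuclideanSpace.single l₀ (3 * r / 2) : Euc n) (r / 4),
        S4.dens v x) := by
    simp only [hd1]
    rw [integral_const_mul, Measure.setIntegral_comp_smul_of_pos volume (S4.dens v) _ hr,
      _root_.smul_ball hr.ne']
    have e1 : r • (EuclideanSpace.single l₀ (3 / 2) : Euc n) =
        EuclideanSpace.single l₀ (3 * r / 2) := by
      ext m
      by_cases hm : m = l₀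
      · subst hm; simp; ring
      · simp [hm]
    rw [e1, Real.norm_of_nonneg hr.le, finrank_euclideanSpace, Fintype.card_fin, smul_eq_mul]
    congr 5
    ring
  have hZ : ∀ x : Euc n, ∑ i, ∑ j, ∑ k, ∑ l, (Zop H i j k l x) ^ 2 = S4.dens v x := by
    intro x
    simp only [S4.dens, S4.Zop_eval H (S4.toP v) hHP]
  simp only [hZ]
  rw [hI] at main
  have hL : ∑ α ∈ MIdx n d, ∑ i, ∑ k,
      (h i k α) ^ 2 * r ^ (2 * (∑ m, (α m : ℝ)) - 4 + (n : ℝ)) =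
      (r ^ n / r ^ 4) * ∑ α, ∑ i, ∑ k, w (i, k, α) ^ 2 := by
    rw [← Finset.sum_coe_sort]
    simp only [Finset.mul_sum _ _ (r ^ n / r ^ 4)]
    refine Finset.sum_congr rfl fun α _ => Finset.sum_congr rfl fun i _ =>
      Finset.sum_congr rfl fun k _ => ?_
    have : r ^ (2 * (∑ m, (α.1 m : ℝ)) - 4 + (n : ℝ)) =
        (r ^ (∑ m, α.1 m)) ^ 2 * (r ^ n / r ^ 4) := by
      have e : (2 * (∑ m, (α.1 m : ℝ)) - 4 + (n : ℝ)) =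
          (((∑ m, α.1 m) * 2 + n : ℕ) : ℝ) - ((4 : ℕ) : ℝ) := by
        push_cast; ring
      rw [e, Real.rpow_sub hr, Real.rpow_natCast, Real.rpow_natCast, pow_add, pow_mul]
      ring
    rw [this]
    simp only [hw, hv]
    ring
  rw [hL]
  set I := ∫ x in Metric.ball (EuclideanSpace.single l₀ (3 * r / 2) : Euc n) (r / 4), S4.dens v x
  calc _ ≤ (r ^ n / r ^ 4) * (K * (r ^ 4 * ((r ^ n)⁻¹ * I))) :=
        mul_le_mul_of_nonneg_left main (by positivity)
    _ = K * I := by field_simp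
end
end
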